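/- arXiv:2404.10489 — 4 statements merged into one kernel-verified Lean document; each statement's English description precedes it below -/
import Mathlib

section
/- For every real t ≥ 0 and r > 0 there holds ∫₀^∞ ω e^{−ω²/2} J₀(rω) cos(tω) dω = 𝒥₀(t,r) + 𝒥₀(−t,r), where 𝒥₀(s,r) = (1/√(2π)) ∫₀^∞ [exp(−(r−s+rξ)²/2) / √(ξ(ξ+2))] · (r−s+rξ) dξ. -/
open MeasureTheory

/-- Bessel function of the first kind of order 0: `J₀(x) = (1/π)∫₀^π cos(x sin φ) dφ`. -/
noncomputable def J0 (x : ℝ) : ℝ :=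
  (1 / Real.pi) * ∫ φ in (0 : ℝ)..Real.pi, Real.cos (x * Real.sin φ)

/-- `𝒥ⱼ(s,r) = (1/√(2π)) ∫₀^∞ exp(−(r−s+rξ)²/2)/√(ξ(ξ+2)) · (r−s+rξ) · (1+ξ)^j dξ`. -/
noncomputable def Jcal (j : ℕ) (s r : ℝ) : ℝ :=
  (1 / Real.sqrt (2 * Real.pi)) * ∫ ξ in Set.Ioi (0 : ℝ),
    Real.exp (-(r - s + r * ξ) ^ 2 / 2) / Real.sqrt (ξ * (ξ + 2)) *
      (r - s + r * ξ) * (1 + ξ) ^ j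

open Filter Topology

lemma J0_eq (x : ℝ) :
    ∫ φ in (0 : ℝ)..(Real.pi / 2), Real.cos (x * Real.cos φ) = Real.pi / 2 * J0 x := by
  have hc : Continuous fun φ : ℝ => Real.cos (x * Real.cos φ) := by fun_prop
  have h1 : ∫ φ in (0 : ℝ)..Real.pi, Real.cos (x * Real.sin φ)
      = ∫ φ in (-(Real.pi / 2))..(Real.pi / 2), Real.cos (x * Real.cos φ) := by
    have := intervalIntegral.integral_comp_add_right (a := -(Real.pi / 2)) (b := Real.pi / 2)
      (fun φ => Real.cos (x * Real.sin φ)) (Real.pi / 2)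
    simp only [Real.sin_add_pi_div_two] at this
    rw [this]
    congr 1 <;> ring
  have h2 : ∫ φ in (-(Real.pi / 2))..(0 : ℝ), Real.cos (x * Real.cos φ)
      = ∫ φ in (0 : ℝ)..(Real.pi / 2), Real.cos (x * Real.cos φ) := by
    have := intervalIntegral.integral_comp_neg (a := (0 : ℝ)) (b := Real.pi / 2)
      (fun φ => Real.cos (x * Real.cos φ))
    simp only [Real.cos_neg, neg_zero] at this
    exact this.symm
  have h3 := intervalIntegral.integral_add_adjacent_intervals
    (hc.intervalIntegrable (μ := volume) (-(Real.pi / 2)) 0)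
    (hc.intervalIntegrable (μ := volume) 0 (Real.pi / 2))
  unfold J0
  rw [h1, ← h3, h2]
  have := Real.pi_ne_zero
  field_simp
  ring

/-- right side of the rectangle -/
noncomputable def Rside (x Θ : ℝ) : ℂ :=
  ∫ y in (0 : ℝ)..(Real.pi / 2),
    Complex.exp (Complex.I * x * Complex.cosh ((Θ : ℂ) + (y : ℂ) * Complex.I))

lemma rside_norm (x Θ y : ℝ) :
    ‖Complex.exp (Complex.I * x * Complex.cosh ((Θ : ℂ) + (y : ℂ) * Complex.I))‖
      = Real.exp (-(x * (Real.sinh Θ * Real.sin y))) := by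
  rw [Complex.norm_exp, Complex.cosh_add, Complex.cosh_mul_I, Complex.sinh_mul_I,
    ← Complex.ofReal_cosh, ← Complex.ofReal_sinh, ← Complex.ofReal_cos, ← Complex.ofReal_sin]
  simp [-Complex.ofReal_sinh, -Complex.ofReal_cosh, -Complex.ofReal_sin, -Complex.ofReal_cos]

lemma sin_nonneg_aux {y : ℝ} (hy : y ∈ Set.uIoc (0 : ℝ) (Real.pi / 2)) : 0 < Real.sin y := by
  have := Real.pi_pos
  rw [Set.uIoc_of_le (by positivity)] at hy
  exact Real.sin_pos_of_pos_of_lt_pi hy.1 (by linarith [hy.2])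

lemma rside_bound {x Θ : ℝ} (hx : 0 ≤ x) (hΘ : 0 ≤ Θ) : ‖Rside x Θ‖ ≤ Real.pi / 2 := by
  have := Real.pi_pos
  have h := intervalIntegral.norm_integral_le_of_norm_le_const (a := (0 : ℝ)) (b := Real.pi / 2)
    (C := 1) (f := fun y : ℝ =>
      Complex.exp (Complex.I * x * Complex.cosh ((Θ : ℂ) + (y : ℂ) * Complex.I))) (by
      intro y hy
      rw [rside_norm]
      have h1 := sin_nonneg_aux hy
      have h2 := Real.sinh_nonneg_iff.2 hΘ
      rw [Real.exp_le_one_iff]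
      have : 0 ≤ x * (Real.sinh Θ * Real.sin y) := by positivity
      linarith)
  rw [sub_zero, one_mul, abs_of_pos (by positivity)] at h
  exact h

lemma tendsto_sinh : Tendsto Real.sinh atTop atTop := by
  refine tendsto_atTop_mono' _ ?_ tendsto_id
  filter_upwards [eventually_ge_atTop 0] with x hx
  exact Real.self_le_sinh_iff.2 hx

lemma rside_tendsto {x : ℝ} (hx : 0 < x) : Tendsto (Rside x) atTop (𝓝 0) := by
  have h0 : (0 : ℂ) = ∫ y in (0 : ℝ)..(Real.pi / 2), (0 : ℂ) := by simp
  rw [h0]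
  unfold Rside
  refine intervalIntegral.tendsto_integral_filter_of_dominated_convergence (fun _ => 1) ?_ ?_ ?_ ?_
  · refine Eventually.of_forall fun Θ => Continuous.aestronglyMeasurable ?_
    fun_prop
  · filter_upwards [eventually_ge_atTop 0] with Θ hΘ
    refine Eventually.of_forall fun y hy => ?_
    rw [rside_norm]
    have h1 := sin_nonneg_aux hy
    have h2 := Real.sinh_nonneg_iff.2 hΘ
    rw [Real.exp_le_one_iff]
    have : 0 ≤ x * (Real.sinh Θ * Real.sin y) := by positivity
    linarith
  · simp
  · refine Eventually.of_forall fun y hy => ?_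
    rw [tendsto_zero_iff_norm_tendsto_zero]
    simp only [rside_norm]
    refine Real.tendsto_exp_neg_atTop_nhds_zero.comp ?_
    exact (tendsto_sinh.atTop_mul_const (sin_nonneg_aux hy)).const_mul_atTop hx

/-- truncated Mehler-Sonine integral -/
noncomputable def Strunc (x Θ : ℝ) : ℝ := ∫ θ in (0 : ℝ)..Θ, Real.sin (x * Real.cosh θ)

lemma strunc_eq (x Θ : ℝ) : Strunc x Θ = Real.pi / 2 * J0 x - (Rside x Θ).re := by
  have h := Complex.integral_boundary_rect_eq_zero_of_differentiableOn
    (fun z => Complex.exp (Complex.I * x * Complex.cosh z)) 0 ⟨Θ, Real.pi / 2⟩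
    (by
      apply Differentiable.differentiableOn
      fun_prop)
  simp only [Complex.zero_re, Complex.zero_im] at h
  have e1 : (∫ θ in (0 : ℝ)..Θ, Complex.exp (Complex.I * x *
      Complex.cosh ((θ : ℂ) + ((0 : ℝ) : ℂ) * Complex.I))).im = Strunc x Θ := by
    have := Complex.imCLM.intervalIntegral_comp_comm (a := 0) (b := Θ) (μ := volume)
      (f := fun θ : ℝ => Complex.exp (Complex.I * x *
      Complex.cosh ((θ : ℂ) + ((0 : ℝ) : ℂ) * Complex.I)))
      (Continuous.intervalIntegrable (by fun_prop) _ _)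
    rw [← Complex.imCLM_apply, ← this]
    unfold Strunc
    congr 1
    ext θ
    simp only [Complex.imCLM_apply, Complex.ofReal_zero, zero_mul, add_zero]
    rw [← Complex.ofReal_cosh, Complex.exp_im]
    simp
  have e2 : (∫ θ in (0 : ℝ)..Θ, Complex.exp (Complex.I * x *
      Complex.cosh ((θ : ℂ) + ((Real.pi / 2 : ℝ) : ℂ) * Complex.I))).im = 0 := by
    have := Complex.imCLM.intervalIntegral_comp_comm (a := 0) (b := Θ) (μ := volume)
      (f := fun θ : ℝ => Complex.exp (Complex.I * x *
      Complex.cosh ((θ : ℂ) + ((Real.pi / 2 : ℝ) : ℂ) * Complex.I)))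
      (Continuous.intervalIntegrable (by fun_prop) _ _)
    rw [← Complex.imCLM_apply, ← this]
    have hz : ∀ θ : ℝ, Complex.imCLM (Complex.exp (Complex.I * x *
      Complex.cosh ((θ : ℂ) + ((Real.pi / 2 : ℝ) : ℂ) * Complex.I))) = 0 := by
      intro θ
      rw [Complex.imCLM_apply, Complex.cosh_add, Complex.cosh_mul_I, Complex.sinh_mul_I,
        ← Complex.ofReal_cosh, ← Complex.ofReal_sinh, ← Complex.ofReal_cos, ← Complex.ofReal_sin,
        Complex.exp_im]
      simp
    simp only [hz]
    simp
  have e3 : (∫ y in (0 : ℝ)..(Real.pi / 2), Complex.exp (Complex.I * x *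
      Complex.cosh (((0 : ℝ) : ℂ) + (y : ℂ) * Complex.I))).re = Real.pi / 2 * J0 x := by
    have := Complex.reCLM.intervalIntegral_comp_comm (a := 0) (b := Real.pi / 2) (μ := volume)
      (f := fun y : ℝ => Complex.exp (Complex.I * x *
      Complex.cosh (((0 : ℝ) : ℂ) + (y : ℂ) * Complex.I)))
      (Continuous.intervalIntegrable (by fun_prop) _ _)
    rw [← Complex.reCLM_apply, ← this, ← J0_eq]
    congr 1
    ext y
    simp only [Complex.reCLM_apply, Complex.ofReal_zero, zero_add]
    rw [Complex.cosh_mul_I, ← Complex.ofReal_cos, Complex.exp_re]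
    simp [-Complex.ofReal_sinh, -Complex.ofReal_cosh, -Complex.ofReal_sin, -Complex.ofReal_cos]
  have h' := congrArg Complex.im h
  simp only [Complex.sub_im, Complex.add_im, smul_eq_mul, Complex.I_mul_im, Complex.zero_im] at h'
  rw [e1, e2, e3] at h'
  unfold Rside
  linarith

lemma integrable_cos_gauss (x : ℝ) :
    Integrable fun ω : ℝ => Real.exp (-ω ^ 2 / 2) * Real.cos (ω * x) := by
  refine (integrable_exp_neg_mul_sq (b := 1 / 2) (by norm_num)).mono'
    (Continuous.aestronglyMeasurable (by fun_prop)) (Eventually.of_forall fun ω => ?_)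
  rw [norm_mul, Real.norm_eq_abs, Real.norm_eq_abs, Real.abs_exp,
    show -ω ^ 2 / 2 = -(1 / 2) * ω ^ 2 by ring]
  exact mul_le_of_le_one_right (Real.exp_pos _).le (Real.abs_cos_le_one _)

lemma integrable_id_gauss : Integrable fun ω : ℝ => ω * Real.exp (-ω ^ 2 / 2) := by
  refine (integrable_mul_exp_neg_mul_sq (b := 1 / 2) (by norm_num)).congr
    (Eventually.of_forall fun ω => ?_)
  simp only
  congr 2
  ring

lemma integrable_sin_gauss (x : ℝ) :
    Integrable fun ω : ℝ => ω * Real.exp (-ω ^ 2 / 2) * Real.sin (ω * x) := by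
  refine integrable_id_gauss.norm.mono'
    (Continuous.aestronglyMeasurable (by fun_prop)) (Eventually.of_forall fun ω => ?_)
  rw [norm_mul]
  exact mul_le_of_le_one_right (norm_nonneg _) (Real.abs_sin_le_one _)

lemma integral_cos_gauss (x : ℝ) :
    ∫ ω : ℝ, Real.exp (-ω ^ 2 / 2) * Real.cos (ω * x)
      = Real.sqrt (2 * Real.pi) * Real.exp (-x ^ 2 / 2) := by
  have h := fourierIntegral_gaussian (b := 1 / 2) (by norm_num) (x : ℂ)
  have hr : (((Real.pi : ℂ) / (1 / 2)) ^ (1 / 2 : ℂ) * Complex.exp (-(x : ℂ) ^ 2 / (4 * (1 / 2))))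
      = ((Real.sqrt (2 * Real.pi) * Real.exp (-x ^ 2 / 2) : ℝ) : ℂ) := by
    rw [Complex.ofReal_mul, Real.sqrt_eq_rpow, Complex.ofReal_cpow (by positivity)]
    push_cast
    congr 2
    · ring
    · ring
  rw [hr] at h
  have hint : Integrable fun ω : ℝ => Complex.exp (Complex.I * x * ω) *
      Complex.exp (-(1 / 2) * (ω : ℂ) ^ 2) := by
    refine (integrable_exp_neg_mul_sq (b := 1 / 2) (by norm_num)).mono'
      (Continuous.aestronglyMeasurable (by fun_prop)) (Eventually.of_forall fun ω => ?_)
    rw [norm_mul, Complex.norm_exp, Complex.norm_exp]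
    simp [← Complex.ofReal_pow]
  have h2 := Complex.reCLM.integral_comp_comm hint
  rw [h, Complex.reCLM_apply, Complex.ofReal_re] at h2
  rw [← h2]
  congr 1
  ext ω
  have : Complex.exp (-(1 / 2) * (ω : ℂ) ^ 2) = ((Real.exp (-ω ^ 2 / 2) : ℝ) : ℂ) := by
    push_cast
    congr 1
    ring
  rw [this, Complex.reCLM_apply, Complex.re_mul_ofReal, Complex.exp_re]
  simp [mul_comm]

lemma integral_sin_gauss (x : ℝ) :
    ∫ ω in Set.Ioi (0 : ℝ), ω * Real.exp (-ω ^ 2 / 2) * Real.sin (ω * x)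
      = Real.pi * (1 / Real.sqrt (2 * Real.pi) * (Real.exp (-x ^ 2 / 2) * x)) := by
  have hhalf : ∫ ω in Set.Ioi (0 : ℝ), Real.exp (-ω ^ 2 / 2) * Real.cos (ω * x)
      = Real.sqrt (2 * Real.pi) * Real.exp (-x ^ 2 / 2) / 2 := by
    have h := integral_comp_abs (f := fun ω => Real.exp (-ω ^ 2 / 2) * Real.cos (ω * x))
    rw [← integral_cos_gauss]
    have h2 : ∀ ω : ℝ, Real.exp (-|ω| ^ 2 / 2) * Real.cos (|ω| * x)
        = Real.exp (-ω ^ 2 / 2) * Real.cos (ω * x) := by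
      intro ω
      rw [sq_abs]
      congr 1
      rcases abs_choice ω with h | h <;> rw [h]
      rw [neg_mul, Real.cos_neg]
    simp only [h2] at h
    linarith
  have hparts := integral_Ioi_of_hasDerivAt_of_tendsto (a := 0) (m := 0)
    (f := fun ω : ℝ => -(Real.exp (-ω ^ 2 / 2) * Real.sin (ω * x)))
    (f' := fun ω : ℝ => ω * Real.exp (-ω ^ 2 / 2) * Real.sin (ω * x)
      - x * (Real.exp (-ω ^ 2 / 2) * Real.cos (ω * x)))
    (Continuous.continuousWithinAt (by fun_prop))
    (by
      intro ω _
      have h1 : HasDerivAt (fun ω : ℝ => -ω ^ 2 / 2) (-ω) ω := by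
        have := ((hasDerivAt_pow 2 ω).neg).div_const 2
        refine this.congr_deriv ?_
        simp; ring
      have h2 : HasDerivAt (fun ω : ℝ => ω * x) x ω := by
        simpa using (hasDerivAt_id ω).mul_const x
      refine (h1.exp.mul h2.sin).neg.congr_deriv ?_
      ring)
    ((integrable_sin_gauss x).sub ((integrable_cos_gauss x).const_mul x)).integrableOn
    (by
      have h1 : Tendsto (fun ω : ℝ => Real.exp (-ω ^ 2 / 2)) atTop (𝓝 0) := by
        refine Real.tendsto_exp_atBot.comp ?_
        have : Tendsto (fun ω : ℝ => ω ^ 2 / 2) atTop atTop :=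
          (tendsto_pow_atTop (by norm_num)).atTop_div_const (by norm_num)
        refine (tendsto_neg_atTop_atBot.comp this).congr fun ω => ?_
        simp only [Function.comp]
        ring
      rw [← neg_zero]
      refine Tendsto.neg ?_
      refine squeeze_zero_norm (fun ω => ?_) h1
      rw [norm_mul, Real.norm_eq_abs, Real.norm_eq_abs, Real.abs_exp]
      exact mul_le_of_le_one_right (Real.exp_pos _).le (Real.abs_sin_le_one _))
  rw [integral_sub (integrable_sin_gauss x).integrableOn
    ((integrable_cos_gauss x).const_mul x).integrableOn, integral_const_mul, hhalf] at hparts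
  simp only [zero_mul, Real.sin_zero, mul_zero, neg_zero, sub_zero] at hparts
  rw [sub_eq_zero.1 hparts]
  have hs : Real.sqrt (2 * Real.pi) ≠ 0 := by positivity
  have hsq : Real.sqrt (2 * Real.pi) ^ 2 = 2 * Real.pi := Real.sq_sqrt (by positivity)
  field_simp
  rw [hsq]
  ring

lemma Jcal_eq (s r : ℝ) :
    Jcal 0 s r = (1 / Real.sqrt (2 * Real.pi)) * ∫ θ in Set.Ioi (0 : ℝ),
      Real.exp (-(r * Real.cosh θ - s) ^ 2 / 2) * (r * Real.cosh θ - s) := by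
  unfold Jcal
  congr 1
  have himg : (fun θ => Real.cosh θ - 1) '' Set.Ioi (0 : ℝ) = Set.Ioi 0 := by
    ext y
    simp only [Set.mem_image, Set.mem_Ioi]
    constructor
    · rintro ⟨θ, h, rfl⟩
      have := Real.one_lt_cosh.2 h.ne'
      linarith
    · intro hy
      refine ⟨Real.arcosh (y + 1), Real.arcosh_pos (by linarith), ?_⟩
      rw [Real.cosh_arcosh (by linarith)]
      ring
  have h := integral_image_eq_integral_abs_deriv_smul (s := Set.Ioi (0 : ℝ))
    (f := fun θ => Real.cosh θ - 1) (f' := Real.sinh) measurableSet_Ioi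
    (fun θ _ => ((Real.hasDerivAt_cosh θ).sub_const 1).hasDerivWithinAt)
    (by
      intro a ha b hb hab
      simp only [sub_left_inj] at hab
      exact Real.cosh_strictMonoOn.injOn (Set.mem_Ici.2 (le_of_lt ha)) (Set.mem_Ici.2 (le_of_lt hb)) hab)
    (fun ξ => Real.exp (-(r - s + r * ξ) ^ 2 / 2) / Real.sqrt (ξ * (ξ + 2)) *
      (r - s + r * ξ) * (1 + ξ) ^ 0)
  rw [himg] at h
  rw [h]
  refine setIntegral_congr_fun measurableSet_Ioi fun θ hθ => ?_
  have hs : 0 < Real.sinh θ := Real.sinh_pos_iff.2 hθ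
  have e : (Real.cosh θ - 1) * (Real.cosh θ - 1 + 2) = Real.sinh θ ^ 2 := by
    rw [Real.sinh_sq]; ring
  simp only [e, Real.sqrt_sq hs.le, abs_of_pos hs, smul_eq_mul, pow_zero, mul_one]
  rw [show r - s + r * (Real.cosh θ - 1) = r * Real.cosh θ - s by ring]
  field_simp

lemma integrable_cosh {s r : ℝ} (hr : 0 < r) : IntegrableOn (fun θ =>
      Real.exp (-(r * Real.cosh θ - s) ^ 2 / 2) * (r * Real.cosh θ - s)) (Set.Ioi 0) := by
  refine ((integrableOn_exp_neg_Ioi 0).const_mul (2 * (2 + |s|) / r)).mono'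
    (Continuous.aestronglyMeasurable (by fun_prop)) (Eventually.of_forall fun θ => ?_)
  have key : ∀ y : ℝ, |Real.exp (-y ^ 2 / 2) * y| * |y + s| ≤ 2 + |s| := by
    intro y
    have he : Real.exp (-y ^ 2 / 2) * (1 + y ^ 2 / 2) ≤ 1 := by
      have := Real.add_one_le_exp (y ^ 2 / 2)
      calc Real.exp (-y ^ 2 / 2) * (1 + y ^ 2 / 2)
          ≤ Real.exp (-y ^ 2 / 2) * Real.exp (y ^ 2 / 2) := by gcongr; linarith
        _ = 1 := by rw [← Real.exp_add]; ring_nf; simp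
    have hp := Real.exp_pos (-y ^ 2 / 2)
    rw [abs_mul, Real.abs_exp]
    set E := Real.exp (-y ^ 2 / 2)
    have hy : |y| ≤ 1 + y ^ 2 / 2 := by
      rw [← sq_abs]; nlinarith [sq_nonneg (|y| - 1)]
    have h1 : E * |y| ≤ 1 := (mul_le_mul_of_nonneg_left hy hp.le).trans he
    have h2 : E * |y| * |y| ≤ 2 := by
      rw [mul_assoc, ← sq, sq_abs]; nlinarith
    calc E * |y| * |y + s| ≤ E * |y| * (|y| + |s|) := by gcongr; exact abs_add_le _ _
      _ = E * |y| * |y| + E * |y| * |s| := by ring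
      _ ≤ 2 + 1 * |s| := by gcongr
      _ = _ := by ring
  have hk := key (r * Real.cosh θ - s)
  rw [sub_add_cancel, abs_of_pos (a := r * Real.cosh θ) (mul_pos hr (Real.cosh_pos θ))] at hk
  rw [Real.norm_eq_abs]
  set A := |Real.exp (-(r * Real.cosh θ - s) ^ 2 / 2) * (r * Real.cosh θ - s)|
  have hA : 0 ≤ A := abs_nonneg _
  have hc : Real.exp θ / 2 ≤ Real.cosh θ := by
    rw [Real.cosh_eq]; have := Real.exp_pos (-θ); linarith
  have h3 : A * (r * (Real.exp θ / 2)) ≤ 2 + |s| := by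
    refine le_trans ?_ hk
    gcongr
  rw [Real.exp_neg, ← div_eq_mul_inv, div_div, le_div_iff₀ (by positivity)]
  linarith

lemma trunc_swap (t r Θ : ℝ) (hΘ : 0 ≤ Θ) :
    ∫ θ in (0 : ℝ)..Θ,
      ((1 / Real.sqrt (2 * Real.pi)) *
        (Real.exp (-(r * Real.cosh θ - t) ^ 2 / 2) * (r * Real.cosh θ - t)) +
      (1 / Real.sqrt (2 * Real.pi)) *
        (Real.exp (-(r * Real.cosh θ - -t) ^ 2 / 2) * (r * Real.cosh θ - -t)))
    = ∫ ω in Set.Ioi (0 : ℝ), 2 / Real.pi * (ω * Real.exp (-ω ^ 2 / 2) * Real.cos (t * ω) *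
        Strunc (r * ω) Θ) := by
  have hpi := Real.pi_pos
  have h1 : ∀ θ : ℝ, ((1 / Real.sqrt (2 * Real.pi)) *
        (Real.exp (-(r * Real.cosh θ - t) ^ 2 / 2) * (r * Real.cosh θ - t)) +
      (1 / Real.sqrt (2 * Real.pi)) *
        (Real.exp (-(r * Real.cosh θ - -t) ^ 2 / 2) * (r * Real.cosh θ - -t)))
      = ∫ ω in Set.Ioi (0 : ℝ), 2 / Real.pi * (ω * Real.exp (-ω ^ 2 / 2) * Real.cos (t * ω) *
        Real.sin (r * ω * Real.cosh θ)) := by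
    intro θ
    have a1 := integral_sin_gauss (r * Real.cosh θ - t)
    have a2 := integral_sin_gauss (r * Real.cosh θ - -t)
    have a3 := integral_add (μ := volume.restrict (Set.Ioi (0 : ℝ)))
      (integrable_sin_gauss (r * Real.cosh θ - t)).integrableOn
      (integrable_sin_gauss (r * Real.cosh θ - -t)).integrableOn
    rw [a1, a2, ← mul_add] at a3
    rw [integral_const_mul]
    have a4 : ∫ ω in Set.Ioi (0 : ℝ), (ω * Real.exp (-ω ^ 2 / 2) * Real.cos (t * ω) *
        Real.sin (r * ω * Real.cosh θ)) = (1 / 2) * ∫ ω in Set.Ioi (0 : ℝ),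
        (ω * Real.exp (-ω ^ 2 / 2) * Real.sin (ω * (r * Real.cosh θ - t)) +
          ω * Real.exp (-ω ^ 2 / 2) * Real.sin (ω * (r * Real.cosh θ - -t))) := by
      rw [← integral_const_mul]
      congr 1
      ext ω
      rw [show ω * (r * Real.cosh θ - t) = r * ω * Real.cosh θ - t * ω by ring,
        show ω * (r * Real.cosh θ - -t) = r * ω * Real.cosh θ + t * ω by ring,
        Real.sin_sub, Real.sin_add]
      ring
    rw [a4, a3]
    field_simp
  simp only [h1]
  rw [intervalIntegral.integral_of_le hΘ, integral_integral_swap]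
  · congr 1
    ext ω
    unfold Strunc
    rw [intervalIntegral.integral_of_le hΘ, integral_const_mul, integral_const_mul]
  · have hb : Integrable (fun z : ℝ × ℝ => (1 : ℝ) * (2 / Real.pi * ‖z.2 * Real.exp (-z.2 ^ 2 / 2)‖))
        ((volume.restrict (Set.Ioc 0 Θ)).prod (volume.restrict (Set.Ioi 0))) :=
      Integrable.mul_prod (f := fun _ : ℝ => (1 : ℝ))
        (g := fun ω : ℝ => 2 / Real.pi * ‖ω * Real.exp (-ω ^ 2 / 2)‖)
        (integrable_const _) ((integrable_id_gauss.norm.const_mul _).integrableOn)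
    refine hb.mono' (Continuous.aestronglyMeasurable (by
      simp only [Function.uncurry_def]; fun_prop)) (Eventually.of_forall fun z => ?_)
    simp only [Function.uncurry_def]
    rw [norm_mul, norm_mul _ (Real.sin _), norm_mul _ (Real.cos _), one_mul,
      Real.norm_of_nonneg (by positivity : 0 ≤ 2 / Real.pi)]
    gcongr
    rw [mul_assoc]
    refine mul_le_of_le_one_right (norm_nonneg _) ?_
    exact mul_le_one₀ (Real.abs_cos_le_one _) (norm_nonneg _) (Real.abs_sin_le_one _)

lemma J0_bound {x : ℝ} : |Real.pi / 2 * J0 x| ≤ Real.pi / 2 := by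
  have hpi := Real.pi_pos
  rw [← J0_eq]
  have h := intervalIntegral.norm_integral_le_of_norm_le_const (a := (0 : ℝ)) (b := Real.pi / 2)
    (C := 1) (f := fun φ : ℝ => Real.cos (x * Real.cos φ)) (fun y _ => Real.abs_cos_le_one _)
  rwa [sub_zero, one_mul, abs_of_pos (by positivity : 0 < Real.pi / 2)] at h

lemma strunc_bound {x Θ : ℝ} (hx : 0 ≤ x) (hΘ : 0 ≤ Θ) : |Strunc x Θ| ≤ Real.pi := by
  rw [strunc_eq]
  have h1 := J0_bound (x := x)
  have h2 := (Complex.abs_re_le_norm _).trans (rside_bound hx hΘ)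
  have h3 := abs_sub (Real.pi / 2 * J0 x) (Rside x Θ).re
  linarith

lemma strunc_tendsto {x : ℝ} (hx : 0 < x) :
    Tendsto (Strunc x) atTop (𝓝 (Real.pi / 2 * J0 x)) := by
  have h := (Complex.continuous_re.tendsto 0).comp (rside_tendsto hx)
  have h2 := (tendsto_const_nhds (x := Real.pi / 2 * J0 x)).sub h
  simp only [Complex.zero_re, sub_zero] at h2
  exact h2.congr fun Θ => (strunc_eq x Θ).symm

theorem stmt_8 (t r : ℝ) (ht : 0 ≤ t) (hr : 0 < r) :
    (∫ ω in Set.Ioi (0 : ℝ), ω * Real.exp (-ω ^ 2 / 2) * J0 (r * ω) * Real.cos (t * ω)) =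
      Jcal 0 t r + Jcal 0 (-t) r := by
  have hpi := Real.pi_pos
  have i1 := (integrable_cosh (s := t) hr).const_mul (1 / Real.sqrt (2 * Real.pi))
  have i2 := (integrable_cosh (s := -t) hr).const_mul (1 / Real.sqrt (2 * Real.pi))
  have hR := intervalIntegral_tendsto_integral_Ioi (0 : ℝ) (i1.add i2) tendsto_id
  have hR' : (∫ θ in Set.Ioi (0 : ℝ), ((1 / Real.sqrt (2 * Real.pi)) *
        (Real.exp (-(r * Real.cosh θ - t) ^ 2 / 2) * (r * Real.cosh θ - t)) +
      (1 / Real.sqrt (2 * Real.pi)) *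
        (Real.exp (-(r * Real.cosh θ - -t) ^ 2 / 2) * (r * Real.cosh θ - -t))))
      = Jcal 0 t r + Jcal 0 (-t) r := by
    rw [integral_add i1 i2, integral_const_mul, integral_const_mul, Jcal_eq, Jcal_eq]
  rw [← hR']
  refine tendsto_nhds_unique ?_ hR
  have hL : Tendsto (fun Θ => ∫ ω in Set.Ioi (0 : ℝ), 2 / Real.pi * (ω * Real.exp (-ω ^ 2 / 2) *
      Real.cos (t * ω) * Strunc (r * ω) Θ)) atTop (𝓝 (∫ ω in Set.Ioi (0 : ℝ),
        ω * Real.exp (-ω ^ 2 / 2) * J0 (r * ω) * Real.cos (t * ω))) := by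
    refine tendsto_integral_filter_of_dominated_convergence
      (fun ω => 2 / Real.pi * (‖ω * Real.exp (-ω ^ 2 / 2)‖ * Real.pi)) ?_ ?_ ?_ ?_
    · refine Eventually.of_forall fun Θ => Continuous.aestronglyMeasurable ?_
      have : Continuous fun ω : ℝ => Strunc (r * ω) Θ := by
        unfold Strunc
        apply intervalIntegral.continuous_parametric_intervalIntegral_of_continuous'
        simp only [Function.uncurry_def]
        fun_prop
      fun_prop
    · filter_upwards [eventually_ge_atTop 0] with Θ hΘ
      refine (ae_restrict_iff' measurableSet_Ioi).2 (Eventually.of_forall fun ω hω => ?_)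
      have hω' : 0 ≤ r * ω := mul_nonneg hr.le (le_of_lt hω)
      rw [norm_mul, norm_mul _ (Strunc _ _), norm_mul _ (Real.cos _),
        Real.norm_of_nonneg (by positivity : 0 ≤ 2 / Real.pi)]
      gcongr
      · exact mul_le_of_le_one_right (norm_nonneg _) (Real.abs_cos_le_one _)
      · exact strunc_bound hω' hΘ
    · exact ((integrable_id_gauss.norm.mul_const _).const_mul _).integrableOn
    · refine (ae_restrict_iff' measurableSet_Ioi).2 (Eventually.of_forall fun ω hω => ?_)
      have h := ((strunc_tendsto (mul_pos hr hω)).const_mul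
        (ω * Real.exp (-ω ^ 2 / 2) * Real.cos (t * ω))).const_mul (2 / Real.pi)
      convert h using 2
      field_simp
  refine hL.congr' ?_
  filter_upwards [eventually_ge_atTop 0] with Θ hΘ
  exact (trunc_swap t r Θ hΘ).symm
end

section
/- For every real t ≥ 0 and r > 0 there holds ∫₀^∞ ω e^{−ω²/2} J₁(rω) sin(tω) dω = 𝒥₁(t,r) − 𝒥₁(−t,r), where 𝒥₁(s,r) = (1/√(2π)) ∫₀^∞ [exp(−(r−s+rξ)²/2) / √(ξ(ξ+2))] · (r−s+rξ) · (1+ξ) dξ. -/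
open MeasureTheory

/-- Bessel function of the first kind of order 1: `J₁(x) = (1/π)∫₀^π cos(φ − x sin φ) dφ`. -/
noncomputable def J1 (x : ℝ) : ℝ :=
  (1 / Real.pi) * ∫ φ in (0 : ℝ)..Real.pi, Real.cos (φ - x * Real.sin φ)

open Set Filter Topology

lemma aux_G_le_one (b : ℝ) : |b * Real.exp (-b ^ 2 / 2)| ≤ 1 := by
  rw [abs_mul, abs_of_pos (Real.exp_pos _)]
  have h1 : |b| ≤ Real.exp (b ^ 2 / 2) := by
    have := Real.add_one_le_exp (b ^ 2 / 2)
    have h2 := sq_abs b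
    nlinarith [sq_nonneg (|b| - 1)]
  calc |b| * Real.exp (-b ^ 2 / 2) ≤ Real.exp (b ^ 2 / 2) * Real.exp (-b ^ 2 / 2) := by gcongr
    _ = 1 := by rw [← Real.exp_add]; ring_nf; simp

lemma aux_G_le_exp (b : ℝ) : |b * Real.exp (-b ^ 2 / 2)| ≤ Real.exp 2 * Real.exp (-b) := by
  rw [abs_mul, abs_of_pos (Real.exp_pos (-b ^ 2 / 2))]
  have h1 : |b| ≤ Real.exp |b| := by
    have := Real.add_one_le_exp |b|
    linarith
  calc |b| * Real.exp (-b ^ 2 / 2) ≤ Real.exp |b| * Real.exp (-b ^ 2 / 2) := by gcongr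
    _ ≤ _ := by
      rw [← Real.exp_add, ← Real.exp_add]
      apply Real.exp_le_exp.2
      have h2 := sq_abs b
      nlinarith [sq_nonneg (|b| - 2), le_abs_self b]

lemma aux_exp_int : IntegrableOn (fun y : ℝ => Real.exp (-y)) (Ioi 0) := by
  simpa using integrableOn_exp_mul_Ioi (a := -1) (by norm_num) 0

lemma aux_cosh_atTop : Tendsto Real.cosh atTop atTop := by
  refine tendsto_atTop_mono (f := fun x => x / 2) ?_ (tendsto_id.atTop_div_const (by norm_num))
  intro x
  rw [Real.cosh_eq]
  have := Real.add_one_le_exp x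
  have := Real.exp_pos (-x)
  linarith

lemma aux_int_exp (r s : ℝ) :
    IntegrableOn (fun y : ℝ => Real.exp (-y) *
      ((r * Real.cosh y - s) * Real.exp (-(r * Real.cosh y - s) ^ 2 / 2))) (Ioi 0) := by
  refine Integrable.mono' aux_exp_int ?_ ?_
  · exact (by fun_prop : Continuous _).aestronglyMeasurable
  · refine Eventually.of_forall fun y => ?_
    rw [norm_mul, Real.norm_of_nonneg (Real.exp_pos _).le]
    have := aux_G_le_one (r * Real.cosh y - s)
    exact mul_le_of_le_one_right (Real.exp_pos _).le this

lemma aux_int_sinh (r s : ℝ) (hr : 0 < r) :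
    IntegrableOn (fun y : ℝ => Real.sinh y *
      ((r * Real.cosh y - s) * Real.exp (-(r * Real.cosh y - s) ^ 2 / 2))) (Ioi 0) := by
  have h : IntegrableOn (fun y : ℝ => Real.sinh y * (r * Real.exp (-(r * Real.cosh y - s)))) (Ioi 0) := by
    refine integrableOn_Ioi_deriv_of_nonneg' (g := fun y => -Real.exp (-(r * Real.cosh y - s))) (l := -0) ?_ ?_ ?_
    · intro x _
      have := ((((Real.hasDerivAt_cosh x).const_mul r).sub_const s).neg.exp).neg
      refine HasDerivAt.congr_deriv this ?_
      simp only [Pi.neg_apply]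
      ring
    · intro x hx
      have := Real.sinh_pos_iff.2 hx
      positivity
    · refine Tendsto.neg ?_
      refine Real.tendsto_exp_neg_atTop_nhds_zero.comp ?_
      exact tendsto_atTop_add_const_right _ _ (aux_cosh_atTop.const_mul_atTop hr)
  refine Integrable.mono' (h.const_mul (Real.exp 2 / r)) ?_ ?_
  · exact (by fun_prop : Continuous _).aestronglyMeasurable
  · refine (ae_restrict_iff' measurableSet_Ioi).2 (Eventually.of_forall fun y hy => ?_)
    have hs : 0 < Real.sinh y := Real.sinh_pos_iff.2 hy
    rw [norm_mul, Real.norm_of_nonneg hs.le]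
    have := aux_G_le_exp (r * Real.cosh y - s)
    calc _ ≤ Real.sinh y * (Real.exp 2 * Real.exp (-(r * Real.cosh y - s))) := by
            gcongr; exact this
      _ = _ := by field_simp

lemma aux_integral_sinh (r s : ℝ) (hr : 0 < r) :
    ∫ y in Ioi (0:ℝ), Real.sinh y *
      ((r * Real.cosh y - s) * Real.exp (-(r * Real.cosh y - s) ^ 2 / 2)) =
      Real.exp (-(r - s) ^ 2 / 2) / r := by
  rw [integral_Ioi_of_hasDerivAt_of_tendsto'
    (f := fun y => -(Real.exp (-(r * Real.cosh y - s) ^ 2 / 2) / r)) (m := -(0 / r)) ?_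
    (aux_int_sinh r s hr) ?_]
  · simp
  · intro x _
    have := ((((((Real.hasDerivAt_cosh x).const_mul r).sub_const s).pow 2).neg.div_const 2).exp.div_const r).neg
    refine HasDerivAt.congr_deriv this ?_
    simp
    field_simp
  · refine (Tendsto.div_const ?_ r).neg
    have h1 : Tendsto (fun y => r * Real.cosh y - s) atTop atTop :=
      tendsto_atTop_add_const_right _ _ (aux_cosh_atTop.const_mul_atTop hr)
    have h2 := (tendsto_pow_atTop (α := ℝ) (two_ne_zero)).comp h1
    have h3 := Real.tendsto_exp_neg_atTop_nhds_zero.comp (h2.atTop_div_const (by norm_num : (0:ℝ) < 2))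
    refine h3.congr fun y => ?_
    simp [neg_div]

lemma aux_Jcal (r s : ℝ) (hr : 0 < r) :
    Jcal 1 s r = (1 / Real.sqrt (2 * Real.pi)) *
      ((∫ y in Ioi (0:ℝ), Real.exp (-y) *
      ((r * Real.cosh y - s) * Real.exp (-(r * Real.cosh y - s) ^ 2 / 2))) +
      Real.exp (-(r - s) ^ 2 / 2) / r) := by
  rw [← aux_integral_sinh r s hr, ← integral_add (aux_int_exp r s) (aux_int_sinh r s hr)]
  unfold Jcal
  congr 1
  have himg : (fun y => Real.cosh y - 1) '' Ioi (0:ℝ) = Ioi 0 := by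
    ext x
    constructor
    · rintro ⟨y, hy, rfl⟩
      have : 1 < Real.cosh y := Real.one_lt_cosh.2 (ne_of_gt hy)
      simpa using this
    · intro hx
      have hx : 0 < x := hx
      refine ⟨Real.arcosh (1 + x), ?_, ?_⟩
      · have := Real.arcosh_pos (x := 1 + x) (by linarith)
        exact this
      · simp [Real.cosh_arcosh (x := 1 + x) (by linarith)]
  rw [← himg, integral_image_eq_integral_abs_deriv_smul (f' := Real.sinh) measurableSet_Ioi
    (fun x _ => ((Real.hasDerivAt_cosh x).sub_const 1).hasDerivWithinAt)]
  · rw [himg]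
    refine setIntegral_congr_fun measurableSet_Ioi fun y hy => ?_
    have hs : 0 < Real.sinh y := Real.sinh_pos_iff.2 hy
    have h1 : (Real.cosh y - 1) * (Real.cosh y - 1 + 2) = Real.sinh y ^ 2 := by
      rw [Real.sinh_sq]; ring
    have h2 : r - s + r * (Real.cosh y - 1) = r * Real.cosh y - s := by ring
    have h3 : Real.exp (-y) = Real.cosh y - Real.sinh y := (Real.cosh_sub_sinh y).symm
    simp only [smul_eq_mul]
    rw [h1, h2, h3, Real.sqrt_sq hs.le, abs_of_pos hs]
    field_simp
    ring
  · intro a ha b hb hab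
    have : Real.cosh a = Real.cosh b := by simpa using hab
    have := Real.cosh_injOn (Ioi_subset_Ici_self ha) (Ioi_subset_Ici_self hb) this
    exact this

/-- Contour shift: the half-period Bessel integral equals a hyperbolic one. -/
lemma aux_contour (x : ℝ) (hx : 0 ≤ x) :
    ∫ φ in (Real.pi / 2)..Real.pi, Real.cos (φ - x * Real.sin φ) =
      -∫ y in Ioi (0:ℝ), Real.exp (-y) * Real.cos (x * Real.cosh y) := by
  set f : ℂ → ℂ := fun z => Complex.exp (Complex.I * (z - x * Complex.sin z)) with hf
  have hfd : Differentiable ℂ f := by fun_prop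
  have hfc : Continuous f := hfd.continuous
  have hpi := Real.pi_pos
  have hrect : ∀ Y : ℝ, (∫ φ in (Real.pi / 2)..Real.pi, f φ)
      - (∫ φ in (Real.pi / 2)..Real.pi, f (φ + Y * Complex.I))
      + Complex.I * (∫ y in (0:ℝ)..Y, f (Real.pi + y * Complex.I))
      - Complex.I * (∫ y in (0:ℝ)..Y, f ((Real.pi / 2 : ℝ) + y * Complex.I)) = 0 := by
    intro Y
    have := Complex.integral_boundary_rect_eq_zero_of_differentiableOn f
      (⟨Real.pi / 2, 0⟩ : ℂ) (⟨Real.pi, Y⟩ : ℂ) hfd.differentiableOn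
    simpa using this
  have hre : ∀ (a b : ℝ) (g : ℝ → ℂ), Continuous g →
      (∫ y in a..b, g y).re = ∫ y in a..b, (g y).re := by
    intro a b g hg
    have := Complex.reCLM.intervalIntegral_comp_comm (hg.intervalIntegrable (μ := volume) a b)
    simpa using this.symm
  have him : ∀ (a b : ℝ) (g : ℝ → ℂ), Continuous g →
      (∫ y in a..b, g y).im = ∫ y in a..b, (g y).im := by
    intro a b g hg
    have := Complex.imCLM.intervalIntegral_comp_comm (hg.intervalIntegrable (μ := volume) a b)
    simpa using this.symm
  have hsin : ∀ a b : ℝ, Complex.sin (a + b * Complex.I) =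
      (Real.sin a * Real.cosh b : ℝ) + (Real.cos a * Real.sinh b : ℝ) * Complex.I := by
    intro a b
    rw [Complex.sin_add_mul_I]
    push_cast
    ring
  have hval : ∀ a b : ℝ, f (a + b * Complex.I) =
      Complex.exp ((-b + x * Real.cos a * Real.sinh b : ℝ) +
        (a - x * (Real.sin a * Real.cosh b) : ℝ) * Complex.I) := by
    intro a b
    simp only [hf]
    rw [hsin]
    congr 1
    push_cast
    ring_nf
    simp only [Complex.I_sq]
    ring
  have key : ∀ Y : ℝ, (∫ φ in (Real.pi / 2)..Real.pi, Real.cos (φ - x * Real.sin φ)) =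
      (∫ φ in (Real.pi / 2)..Real.pi, f (φ + Y * Complex.I)).re
      - ∫ y in (0:ℝ)..Y, Real.exp (-y) * Real.cos (x * Real.cosh y) := by
    intro Y
    have h := congrArg Complex.re (hrect Y)
    simp only [Complex.add_re, Complex.sub_re, Complex.mul_re, Complex.I_re, Complex.I_im,
      Complex.zero_re, zero_mul, one_mul, zero_sub] at h
    rw [hre _ _ _ (by fun_prop), him _ _ _ (by fun_prop), him _ _ _ (by fun_prop)] at h
    have e1 : ∀ φ : ℝ, (f φ).re = Real.cos (φ - x * Real.sin φ) := by
      intro φ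
      have := hval φ 0
      simp only [Complex.ofReal_zero, zero_mul, add_zero] at this
      rw [this, Complex.exp_re]
      rw [Real.sinh_zero, Real.cosh_zero]
      simp [-Complex.ofReal_sin, -Complex.ofReal_sub, -Complex.ofReal_mul]
    have e2 : ∀ y : ℝ, (f (Real.pi + y * Complex.I)).im = 0 := by
      intro y
      rw [hval, Complex.exp_im]
      simp
    have e3 : ∀ y : ℝ, (f ((Real.pi / 2 : ℝ) + y * Complex.I)).im =
        Real.exp (-y) * Real.cos (x * Real.cosh y) := by
      intro y
      rw [hval, Complex.exp_im]
      simp [-Complex.ofReal_div, Real.sin_pi_div_two_sub]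
    simp only [e1, e2, e3, intervalIntegral.integral_zero] at h
    linarith
  have hint : IntegrableOn (fun y : ℝ => Real.exp (-y) * Real.cos (x * Real.cosh y)) (Ioi 0) := by
    refine Integrable.mono' aux_exp_int ?_ ?_
    · exact (by fun_prop : Continuous _).aestronglyMeasurable
    · refine Eventually.of_forall fun y => ?_
      rw [norm_mul, Real.norm_of_nonneg (Real.exp_pos _).le]
      exact mul_le_of_le_one_right (Real.exp_pos _).le (Real.abs_cos_le_one _)
  have hlim1 := intervalIntegral_tendsto_integral_Ioi (0:ℝ) hint tendsto_id
  have hlim2 : Tendsto (fun Y : ℝ => (∫ φ in (Real.pi / 2)..Real.pi, f (φ + Y * Complex.I)).re)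
      atTop (𝓝 0) := by
    have hb : ∀ Y : ℝ, 0 ≤ Y → |(∫ φ in (Real.pi / 2)..Real.pi, f (φ + Y * Complex.I)).re| ≤
        Real.exp (-Y) * |Real.pi - Real.pi / 2| := by
      intro Y hY
      refine (Complex.abs_re_le_norm _).trans ?_
      refine intervalIntegral.norm_integral_le_of_norm_le_const fun φ hφ => ?_
      rw [uIoc_of_le (by linarith)] at hφ
      rw [hval, Complex.norm_exp]
      apply Real.exp_le_exp.2
      have hc : Real.cos φ ≤ 0 :=
        Real.cos_nonpos_of_pi_div_two_le_of_le hφ.1.le (by linarith [hφ.2])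
      have hs : 0 ≤ Real.sinh Y := Real.sinh_nonneg_iff.2 hY
      have : x * Real.cos φ * Real.sinh Y ≤ 0 :=
        mul_nonpos_of_nonpos_of_nonneg (mul_nonpos_of_nonneg_of_nonpos hx hc) hs
      rw [Complex.add_re, Complex.re_ofReal_mul, Complex.ofReal_re, Complex.I_re, mul_zero, add_zero]
      linarith
    have h0 : Tendsto (fun Y : ℝ => Real.exp (-Y) * |Real.pi - Real.pi / 2|) atTop (𝓝 0) := by
      simpa using Real.tendsto_exp_neg_atTop_nhds_zero.mul_const |Real.pi - Real.pi / 2|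
    refine squeeze_zero_norm' ?_ h0
    filter_upwards [eventually_ge_atTop (0:ℝ)] with Y hY using hb Y hY
  have hlim := hlim2.sub hlim1
  rw [zero_sub] at hlim
  refine tendsto_nhds_unique (tendsto_const_nhds (f := (atTop : Filter ℝ))) ?_
  exact hlim.congr fun Y => (key Y).symm

lemma aux_J1 (x : ℝ) (hx : 0 ≤ x) :
    J1 x = (2 / Real.pi) * ((∫ v in Ioc (0:ℝ) 1, 1 * Real.cos (x * v)) -
      ∫ y in Ioi (0:ℝ), Real.exp (-y) * Real.cos (x * Real.cosh y)) := by
  have hc := aux_contour x hx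
  have h1 : ∫ φ in (0:ℝ)..(Real.pi / 2), Real.cos (φ - x * Real.sin φ) =
      ∫ φ in (Real.pi / 2)..Real.pi, -Real.cos (φ + x * Real.sin φ) := by
    have := intervalIntegral.integral_comp_sub_left
      (fun φ => Real.cos (φ - x * Real.sin φ)) (a := Real.pi / 2) (b := Real.pi) Real.pi
    rw [sub_self, show Real.pi - Real.pi / 2 = Real.pi / 2 by ring] at this
    rw [← this]
    refine intervalIntegral.integral_congr fun φ _ => ?_
    simp only [Real.sin_pi_sub]
    rw [← Real.cos_pi_sub]
    congr 1
    ring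
  have h2 : ∫ φ in (Real.pi / 2)..Real.pi, Real.cos (x * Real.sin φ) * Real.cos φ =
      ∫ v in (1:ℝ)..0, Real.cos (x * v) := by
    have := intervalIntegral.integral_comp_mul_deriv (a := Real.pi / 2) (b := Real.pi)
      (f := Real.sin) (f' := Real.cos) (g := fun v => Real.cos (x * v))
      (fun φ _ => Real.hasDerivAt_sin φ) Real.continuous_cos.continuousOn (by fun_prop)
    simpa using this
  have h3 : ∫ φ in (Real.pi / 2)..Real.pi, -Real.cos (φ + x * Real.sin φ) =
      (∫ φ in (Real.pi / 2)..Real.pi, Real.cos (φ - x * Real.sin φ)) -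
      2 * ∫ φ in (Real.pi / 2)..Real.pi, Real.cos (x * Real.sin φ) * Real.cos φ := by
    rw [← intervalIntegral.integral_const_mul, ← intervalIntegral.integral_sub]
    · refine intervalIntegral.integral_congr fun φ _ => ?_
      simp only [Real.cos_add, Real.cos_sub]
      ring
    · exact (by fun_prop : Continuous _).intervalIntegrable _ _
    · exact (by fun_prop : Continuous _).intervalIntegrable _ _
  unfold J1
  rw [← intervalIntegral.integral_add_adjacent_intervals (b := Real.pi / 2)
    ((by fun_prop : Continuous _).intervalIntegrable _ _)
    ((by fun_prop : Continuous _).intervalIntegrable _ _), h1, h3, h2, hc,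
    intervalIntegral.integral_symm, intervalIntegral.integral_of_le zero_le_one]
  simp only [one_mul]
  ring

lemma aux_gauss_int : Integrable (fun w : ℝ => Real.exp (-w ^ 2 / 2)) := by
  have := integrable_exp_neg_mul_sq (b := 1 / 2) (by norm_num)
  refine this.congr (Eventually.of_forall fun w => ?_)
  simp only
  congr 1
  ring

lemma aux_mulgauss_int : Integrable (fun w : ℝ => w * Real.exp (-w ^ 2 / 2)) := by
  have := integrable_mul_exp_neg_mul_sq (b := 1 / 2) (by norm_num)
  refine this.congr (Eventually.of_forall fun w => ?_)
  simp only
  congr 2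
  ring

lemma aux_gauss_cos_int (b : ℝ) :
    Integrable (fun w : ℝ => Real.exp (-w ^ 2 / 2) * Real.cos (b * w)) := by
  refine Integrable.mono' aux_gauss_int ?_ ?_
  · exact (by fun_prop : Continuous _).aestronglyMeasurable
  · refine Eventually.of_forall fun y => ?_
    rw [norm_mul, Real.norm_of_nonneg (Real.exp_pos _).le]
    exact mul_le_of_le_one_right (Real.exp_pos _).le (Real.abs_cos_le_one _)

lemma aux_mulgauss_sin_int (b : ℝ) :
    Integrable (fun w : ℝ => w * Real.exp (-w ^ 2 / 2) * Real.sin (b * w)) := by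
  refine Integrable.mono' aux_mulgauss_int.norm ?_ ?_
  · exact (by fun_prop : Continuous _).aestronglyMeasurable
  · refine Eventually.of_forall fun y => ?_
    rw [norm_mul]
    exact mul_le_of_le_one_right (norm_nonneg _) (Real.abs_sin_le_one _)

lemma aux_gauss_cos (b : ℝ) :
    ∫ w in Ioi (0:ℝ), Real.exp (-w ^ 2 / 2) * Real.cos (b * w) =
      Real.sqrt (2 * Real.pi) / 2 * Real.exp (-b ^ 2 / 2) := by
  have h1 : ∫ w : ℝ, Real.exp (-w ^ 2 / 2) * Real.cos (b * w) =
      2 * ∫ w in Ioi (0:ℝ), Real.exp (-w ^ 2 / 2) * Real.cos (b * w) := by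
    rw [← integral_comp_abs (f := fun w => Real.exp (-w ^ 2 / 2) * Real.cos (b * w))]
    congr 1
    ext w
    rw [sq_abs]
    rcases abs_choice w with h | h <;> simp [h]
  have h2 := fourierIntegral_gaussian (b := (1 / 2 : ℂ)) (by norm_num) (b : ℂ)
  have h3 : ∫ w : ℝ, Real.exp (-w ^ 2 / 2) * Real.cos (b * w) =
      (∫ x : ℝ, Complex.exp (Complex.I * b * x) * Complex.exp (-(1 / 2) * x ^ 2)).re := by
    have hi : Integrable (fun x : ℝ =>
        Complex.exp (Complex.I * b * x) * Complex.exp (-(1 / 2) * x ^ 2)) := by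
      refine Integrable.mono' aux_gauss_int ?_ ?_
      · exact (by fun_prop : Continuous _).aestronglyMeasurable
      · refine Eventually.of_forall fun x => le_of_eq ?_
        rw [norm_mul, Complex.norm_exp, Complex.norm_exp, ← Real.exp_add]
        congr 1
        simp [← Complex.ofReal_pow]
        ring
    have := Complex.reCLM.integral_comp_comm hi
    simp only [Complex.reCLM_apply] at this
    rw [← this]
    congr 1
    ext w
    rw [← Complex.exp_add, Complex.exp_re]
    simp [← Complex.ofReal_pow]
    ring_nf
    simp
  have h4 : ((Real.pi / (1 / 2) : ℂ) ^ (1 / 2 : ℂ) * Complex.exp (-(b:ℂ) ^ 2 / (4 * (1 / 2)))) =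
      ((Real.sqrt (2 * Real.pi) * Real.exp (-b ^ 2 / 2) : ℝ) : ℂ) := by
    rw [Real.sqrt_eq_rpow]
    push_cast
    rw [Complex.ofReal_cpow (by positivity)]
    push_cast
    ring_nf
  rw [h2, h4, Complex.ofReal_re, h1] at h3
  linarith

lemma aux_gauss_sin (b : ℝ) :
    ∫ w in Ioi (0:ℝ), w * Real.exp (-w ^ 2 / 2) * Real.sin (b * w) =
      Real.sqrt (2 * Real.pi) / 2 * (b * Real.exp (-b ^ 2 / 2)) := by
  have h1 : ∫ w in Ioi (0:ℝ), (w * Real.exp (-w ^ 2 / 2) * Real.sin (b * w) -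
      b * (Real.exp (-w ^ 2 / 2) * Real.cos (b * w))) = 0 := by
    rw [integral_Ioi_of_hasDerivAt_of_tendsto'
      (f := fun w => -(Real.exp (-w ^ 2 / 2) * Real.sin (b * w))) (m := 0)
      (f' := fun w => w * Real.exp (-w ^ 2 / 2) * Real.sin (b * w) -
      b * (Real.exp (-w ^ 2 / 2) * Real.cos (b * w))) ?_
      ((aux_mulgauss_sin_int b).integrableOn.sub ((aux_gauss_cos_int b).integrableOn.const_mul b)) ?_]
    · simp
    · intro x _
      have h2 := (((hasDerivAt_id x).pow 2).neg.div_const 2).exp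
      have h3 := ((hasDerivAt_id x).const_mul b).sin
      refine HasDerivAt.congr_deriv (h2.mul h3).neg ?_
      simp
      ring
    · have h3 : Tendsto (fun w : ℝ => Real.exp (-w ^ 2 / 2)) atTop (𝓝 0) := by
        have h2 := (tendsto_pow_atTop (α := ℝ) (two_ne_zero))
        have h3 := Real.tendsto_exp_neg_atTop_nhds_zero.comp
          (h2.atTop_div_const (by norm_num : (0:ℝ) < 2))
        refine h3.congr fun y => ?_
        simp [neg_div]
      refine squeeze_zero_norm (fun w => ?_) h3
      rw [norm_neg, norm_mul, Real.norm_of_nonneg (Real.exp_pos _).le]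
      exact mul_le_of_le_one_right (Real.exp_pos _).le (Real.abs_sin_le_one _)
  rw [integral_sub (aux_mulgauss_sin_int b).integrableOn
    ((aux_gauss_cos_int b).integrableOn.const_mul b), integral_const_mul, aux_gauss_cos] at h1
  linarith

lemma aux_C (t a : ℝ) :
    ∫ w in Ioi (0:ℝ), w * Real.exp (-w ^ 2 / 2) * Real.sin (t * w) * Real.cos (w * a) =
      Real.sqrt (2 * Real.pi) / 4 * ((a - -t) * Real.exp (-(a - -t) ^ 2 / 2) -
        (a - t) * Real.exp (-(a - t) ^ 2 / 2)) := by
  have h : ∀ w : ℝ, w * Real.exp (-w ^ 2 / 2) * Real.sin (t * w) * Real.cos (w * a) =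
      (1 / 2) * (w * Real.exp (-w ^ 2 / 2) * Real.sin ((a - -t) * w) -
        w * Real.exp (-w ^ 2 / 2) * Real.sin ((a - t) * w)) := by
    intro w
    rw [show (a - -t) * w = w * a + t * w by ring, show (a - t) * w = w * a - t * w by ring,
      Real.sin_add, Real.sin_sub]
    ring
  simp only [h]
  rw [integral_const_mul, integral_sub (aux_mulgauss_sin_int _).integrableOn
    (aux_mulgauss_sin_int _).integrableOn, aux_gauss_sin, aux_gauss_sin]
  ring

lemma aux_fubini_int (t r : ℝ) (ν : Measure ℝ) [SFinite ν] (p c : ℝ → ℝ) (hp : Integrable p ν)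
    (hc : Continuous c) :
    Integrable (fun z : ℝ × ℝ => (z.1 * Real.exp (-z.1 ^ 2 / 2) * Real.sin (t * z.1)) *
      (p z.2 * Real.cos (r * z.1 * c z.2))) ((volume.restrict (Ioi 0)).prod ν) := by
  have h1 := ((aux_mulgauss_sin_int t).integrableOn (s := Ioi 0)).mul_prod hp
  refine Integrable.mono' h1.norm ?_ ?_
  · have hcos : AEStronglyMeasurable (fun z : ℝ × ℝ => Real.cos (r * z.1 * c z.2))
        ((volume.restrict (Ioi 0)).prod ν) :=
      (by fun_prop : Continuous _).aestronglyMeasurable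
    refine (h1.aestronglyMeasurable.mul hcos).congr (Eventually.of_forall fun z => ?_)
    simp only [Pi.mul_apply]
    ring
  · refine Eventually.of_forall fun z => ?_
    rw [← mul_assoc, norm_mul]
    exact mul_le_of_le_one_right (norm_nonneg _) (Real.abs_cos_le_one _)

lemma aux_fubini (t r : ℝ) (ν : Measure ℝ) [SFinite ν] (p c : ℝ → ℝ) (hp : Integrable p ν)
    (hc : Continuous c) :
    Integrable (fun w : ℝ => w * Real.exp (-w ^ 2 / 2) * Real.sin (t * w) *
      ∫ y, p y * Real.cos (r * w * c y) ∂ν) (volume.restrict (Ioi 0)) ∧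
    ∫ w in Ioi (0:ℝ), w * Real.exp (-w ^ 2 / 2) * Real.sin (t * w) *
      ∫ y, p y * Real.cos (r * w * c y) ∂ν =
    ∫ y, p y * (Real.sqrt (2 * Real.pi) / 4 *
      ((r * c y - -t) * Real.exp (-(r * c y - -t) ^ 2 / 2) -
        (r * c y - t) * Real.exp (-(r * c y - t) ^ 2 / 2))) ∂ν := by
  have hI := aux_fubini_int t r ν p c hp hc
  constructor
  · have := hI.integral_prod_left
    simpa only [integral_const_mul] using this
  · have := integral_integral_swap (f := fun w y => (w * Real.exp (-w ^ 2 / 2) * Real.sin (t * w)) *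
      (p y * Real.cos (r * w * c y))) hI
    simp only [integral_const_mul] at this
    rw [this]
    congr 1
    ext y
    rw [← aux_C, ← integral_const_mul]
    congr 1
    ext w
    rw [show r * w * c y = w * (r * c y) by ring]
    ring

lemma aux_unit (r s : ℝ) (hr : 0 < r) :
    ∫ v in Ioc (0:ℝ) 1, (r * v - s) * Real.exp (-(r * v - s) ^ 2 / 2) =
      Real.exp (-s ^ 2 / 2) / r - Real.exp (-(r - s) ^ 2 / 2) / r := by
  rw [← intervalIntegral.integral_of_le zero_le_one,
    intervalIntegral.integral_eq_sub_of_hasDerivAt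
    (f := fun y => -(Real.exp (-(r * y - s) ^ 2 / 2) / r))]
  · simp
    ring
  · intro x _
    have := ((((((hasDerivAt_id x).const_mul r).sub_const s).pow 2).neg.div_const 2).exp.div_const r).neg
    refine HasDerivAt.congr_deriv this ?_
    simp
    field_simp
  · exact (by fun_prop : Continuous _).intervalIntegrable _ _

theorem stmt_9 (t r : ℝ) (ht : 0 ≤ t) (hr : 0 < r) :
    (∫ ω in Set.Ioi (0 : ℝ), ω * Real.exp (-ω ^ 2 / 2) * J1 (r * ω) * Real.sin (t * ω)) =
      Jcal 1 t r - Jcal 1 (-t) r := by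
  obtain ⟨hA1, hA2⟩ := aux_fubini t r (volume.restrict (Ioc 0 1)) (fun _ => 1) (fun v => v)
    (integrable_const _) continuous_id
  obtain ⟨hB1, hB2⟩ := aux_fubini t r (volume.restrict (Ioi 0)) (fun y => Real.exp (-y)) Real.cosh
    aux_exp_int Real.continuous_cosh
  have hL : (∫ ω in Set.Ioi (0 : ℝ), ω * Real.exp (-ω ^ 2 / 2) * J1 (r * ω) * Real.sin (t * ω)) =
      ∫ w in Ioi (0:ℝ), (2 / Real.pi) * (w * Real.exp (-w ^ 2 / 2) * Real.sin (t * w) *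
      (∫ v in Ioc (0:ℝ) 1, 1 * Real.cos (r * w * v)) -
      w * Real.exp (-w ^ 2 / 2) * Real.sin (t * w) *
      ∫ y in Ioi (0:ℝ), Real.exp (-y) * Real.cos (r * w * Real.cosh y)) := by
    refine setIntegral_congr_fun measurableSet_Ioi fun w hw => ?_
    rw [aux_J1 (r * w) (mul_nonneg hr.le (le_of_lt hw))]
    ring
  have hU : ∫ v in Ioc (0:ℝ) 1, 1 * (Real.sqrt (2 * Real.pi) / 4 *
      ((r * v - -t) * Real.exp (-(r * v - -t) ^ 2 / 2) -
        (r * v - t) * Real.exp (-(r * v - t) ^ 2 / 2))) =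
      Real.sqrt (2 * Real.pi) / 4 * (Real.exp (-(r - t) ^ 2 / 2) / r -
        Real.exp (-(r - -t) ^ 2 / 2) / r) := by
    simp only [one_mul]
    rw [integral_const_mul, integral_sub, aux_unit r (-t) hr, aux_unit r t hr]
    · rw [neg_sq]; ring
    · exact (by fun_prop : Continuous _).integrableOn_Ioc
    · exact (by fun_prop : Continuous _).integrableOn_Ioc
  have hV : ∫ y in Ioi (0:ℝ), Real.exp (-y) * (Real.sqrt (2 * Real.pi) / 4 *
      ((r * Real.cosh y - -t) * Real.exp (-(r * Real.cosh y - -t) ^ 2 / 2) -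
        (r * Real.cosh y - t) * Real.exp (-(r * Real.cosh y - t) ^ 2 / 2))) =
      Real.sqrt (2 * Real.pi) / 4 * ((∫ y in Ioi (0:ℝ), Real.exp (-y) *
        ((r * Real.cosh y - -t) * Real.exp (-(r * Real.cosh y - -t) ^ 2 / 2))) -
        ∫ y in Ioi (0:ℝ), Real.exp (-y) *
        ((r * Real.cosh y - t) * Real.exp (-(r * Real.cosh y - t) ^ 2 / 2))) := by
    rw [← integral_sub (aux_int_exp r (-t)) (aux_int_exp r t), ← integral_const_mul]
    congr 1
    ext y
    ring
  rw [hL, integral_const_mul, integral_sub hA1 hB1, hA2, hB2, hU, hV, aux_Jcal r t hr,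
    aux_Jcal r (-t) hr]
  have hs : Real.sqrt (2 * Real.pi) ^ 2 = 2 * Real.pi := Real.sq_sqrt (by positivity)
  have hs0 : 0 < Real.sqrt (2 * Real.pi) := Real.sqrt_pos.2 (by positivity)
  have hk : (2 / Real.pi) * (Real.sqrt (2 * Real.pi) / 4) = 1 / Real.sqrt (2 * Real.pi) := by
    have hpi := Real.pi_pos
    field_simp
    rw [hs]
    ring
  rw [← hk]
  ring
end

section
/- For every real t ≥ 0 and r > 0 there holds ∫₀^∞ e^{−ω²/2} sin(ωt) J₀(rω) dω = W̃(t,r) − W̃(−t,r), where W̃(s,r) = (1/√(2π)) ∫₀^∞ [1/(√ξ · √(ξ+2))] · exp(−(r−s+ξr)²/2) dξ. -/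
open MeasureTheory

/-- `W̃(s,r) = (1/√(2π)) ∫₀^∞ exp(−(r−s+ξr)²/2)/(√ξ √(ξ+2)) dξ`. -/
noncomputable def Wtilde (s r : ℝ) : ℝ :=
  (1 / Real.sqrt (2 * Real.pi)) * ∫ ξ in Set.Ioi (0 : ℝ),
    1 / (Real.sqrt ξ * Real.sqrt (ξ + 2)) * Real.exp (-(r - s + ξ * r) ^ 2 / 2)

lemma J0_complex (x : ℝ) : ((J0 x : ℝ) : ℂ) =
    (1 / (2 * Real.pi) : ℂ) * ∫ φ in (0 : ℝ)..(2 * Real.pi), Complex.exp (Complex.I * x * Real.sin φ) := by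
  have hc : Continuous fun φ : ℝ => Complex.exp (Complex.I * x * Real.sin φ) := by fun_prop
  have hc' : Continuous fun φ : ℝ => Complex.exp (-(Complex.I * x * Real.sin φ)) := by fun_prop
  have h2 : ∫ φ in (Real.pi)..(2 * Real.pi), Complex.exp (Complex.I * x * Real.sin φ)
      = ∫ φ in (0 : ℝ)..Real.pi, Complex.exp (-(Complex.I * x * Real.sin φ)) := by
    have := intervalIntegral.integral_comp_add_right (a := 0) (b := Real.pi)
      (fun φ : ℝ => Complex.exp (Complex.I * x * Real.sin φ)) Real.pi
    rw [zero_add, ← two_mul] at this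
    rw [← this]
    congr 1
    ext φ
    rw [Real.sin_add_pi]
    push_cast
    ring_nf
  rw [← intervalIntegral.integral_add_adjacent_intervals (hc.intervalIntegrable 0 Real.pi)
    (hc.intervalIntegrable _ _), h2, ← intervalIntegral.integral_add
    (hc.intervalIntegrable _ _) (hc'.intervalIntegrable _ _)]
  have h3 : ∀ φ : ℝ, Complex.exp (Complex.I * x * Real.sin φ) +
      Complex.exp (-(Complex.I * x * Real.sin φ)) = 2 * ((Real.cos (x * Real.sin φ) : ℝ) : ℂ) := by
    intro φ
    rw [Complex.ofReal_cos, Complex.cos]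
    push_cast
    ring_nf
  simp_rw [h3]
  rw [intervalIntegral.integral_const_mul, intervalIntegral.integral_ofReal, J0]
  push_cast
  ring

lemma J0_continuous : Continuous J0 := by
  unfold J0
  refine continuous_const.mul ?_
  apply intervalIntegral.continuous_parametric_intervalIntegral_of_continuous'
  fun_prop

lemma J0_abs_le (x : ℝ) : |J0 x| ≤ 1 := by
  unfold J0
  have h := intervalIntegral.norm_integral_le_of_norm_le_const (a := 0) (b := Real.pi) (C := 1)
    (f := fun φ => Real.cos (x * Real.sin φ)) (fun φ _ => by
      rw [Real.norm_eq_abs]; exact Real.abs_cos_le_one _)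
  rw [Real.norm_eq_abs, sub_zero, one_mul, abs_of_pos Real.pi_pos] at h
  rw [abs_mul, abs_of_pos (by positivity)]
  calc _ ≤ 1 / Real.pi * Real.pi := by gcongr
    _ = 1 := by field_simp

lemma contour (p w : ℂ) (r : ℝ) (hr : 0 < r) (hp : 0 < p.re) (hw : 0 < w.re)
    (h : w ^ 2 = p ^ 2 + r ^ 2) :
    ∫ φ in (0 : ℝ)..(2 * Real.pi), 1 / (p - Complex.I * r * Real.sin φ) = 2 * Real.pi / w := by
  have hr' : (r : ℂ) ≠ 0 := by exact_mod_cast hr.ne'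
  have hw0 : w ≠ 0 := by rintro rfl; simp at hw
  set a : ℂ := (p - w) / r with ha
  set b : ℂ := (p + w) / r with hb
  have hab : a * b = -1 := by
    rw [ha, hb]; field_simp; linear_combination -h
  have hsub : a - b = -2 * w / r := by
    rw [ha, hb]; field_simp; ring
  have him := congrArg Complex.im h
  have hpw : 0 < p.re * w.re + p.im * w.im := by
    simp [pow_two] at him
    have : 0 ≤ p.im * w.im := by
      have h1 : w.re * w.im = p.re * p.im := by linarith
      have : 0 ≤ w.re * (p.im * w.im) := by
        have : w.re * (p.im * w.im) = p.re * p.im ^ 2 := by linear_combination p.im * h1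
        rw [this]; positivity
      exact nonneg_of_mul_nonneg_right this hw
    positivity
  have hlt : ‖a‖ < ‖b‖ := by
    rw [ha, hb, norm_div, norm_div]
    have : ‖p - w‖ < ‖p + w‖ := by
      apply lt_of_pow_lt_pow_left₀ 2 (norm_nonneg _)
      rw [Complex.sq_norm, Complex.sq_norm, Complex.normSq_apply, Complex.normSq_apply]
      simp
      nlinarith
    gcongr
  have hn : ‖a‖ * ‖b‖ = 1 := by rw [← norm_mul, hab]; simp
  have ha1 : ‖a‖ < 1 := by nlinarith [norm_nonneg a, norm_nonneg b]
  have hb1 : 1 < ‖b‖ := by nlinarith [norm_nonneg a, norm_nonneg b]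
  have i1 : ∮ z in C(0, 1), (z - a)⁻¹ = 2 * Real.pi * Complex.I :=
    circleIntegral.integral_sub_inv_of_mem_ball (by simpa using ha1)
  have hzb : ∀ z ∈ Metric.closedBall (0 : ℂ) 1, z - b ≠ 0 := by
    intro z hz hzb
    rw [sub_eq_zero] at hzb
    subst hzb
    simp at hz
    linarith
  have i2 : ∮ z in C(0, 1), (z - b)⁻¹ = 0 := by
    apply Complex.circleIntegral_eq_zero_of_differentiable_on_off_countable zero_le_one
      Set.countable_empty
    · exact ContinuousOn.inv₀ (by fun_prop) hzb
    · intro z hz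
      exact DifferentiableAt.inv (by fun_prop) (hzb z (Metric.ball_subset_closedBall hz.1))
  have hza : ∀ z ∈ Metric.sphere (0 : ℂ) 1, z - a ≠ 0 := by
    intro z hz hzb
    rw [sub_eq_zero] at hzb
    subst hzb
    simp at hz
    linarith
  have i3 : ∮ z in C(0, 1), ((z - a)⁻¹ - (z - b)⁻¹) = 2 * Real.pi * Complex.I := by
    rw [circleIntegral.integral_sub, i1, i2, sub_zero]
    · exact ContinuousOn.circleIntegrable zero_le_one (ContinuousOn.inv₀ (by fun_prop) hza)
    · exact ContinuousOn.circleIntegrable zero_le_one (ContinuousOn.inv₀ (by fun_prop)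
        (fun z hz => hzb z (Metric.sphere_subset_closedBall hz)))
  rw [circleIntegral] at i3
  have key : ∀ φ : ℝ, 1 / (p - Complex.I * r * Real.sin φ) =
      (-Complex.I / w) * (deriv (circleMap 0 1) φ • ((circleMap 0 1 φ - a)⁻¹ - (circleMap 0 1 φ - b)⁻¹)) := by
    intro φ
    have hm : circleMap 0 1 φ ∈ Metric.sphere (0 : ℂ) 1 := circleMap_mem_sphere _ zero_le_one _
    have h1 := hza _ hm
    have h2 := hzb _ (Metric.sphere_subset_closedBall hm)
    have hs : 2 * Complex.I * Real.sin φ * circleMap 0 1 φ = circleMap 0 1 φ ^ 2 - 1 := by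
      rw [circleMap, Complex.ofReal_sin, Complex.sin]
      have : Complex.exp (-φ * Complex.I) * Complex.exp (φ * Complex.I) = 1 := by
        rw [← Complex.exp_add]; simp
      simp only [zero_add, Complex.ofReal_one, one_mul]
      linear_combination (Complex.I ^ 2 ) * this - Complex.exp (φ * Complex.I) ^ 2 * Complex.I_sq + Complex.I_sq
    rw [deriv_circleMap, smul_eq_mul, inv_sub_inv h1 h2]
    set z := circleMap 0 1 φ with hz
    have hz0 : z ≠ 0 := by
      intro h0; rw [h0] at hm; simp at hm
    have hden : (z - a) * (z - b) = -2 * z / r * (p - Complex.I * r * Real.sin φ) := by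
      have : a + b = 2 * p / r := by rw [ha, hb]; field_simp; ring
      have e : (z - a) * (z - b) = z ^ 2 - (a + b) * z + a * b := by ring
      rw [e, this, hab]
      field_simp
      linear_combination (-(r : ℂ)) * hs
    have hden0 : p - Complex.I * r * Real.sin φ ≠ 0 := by
      intro h0
      have := congrArg Complex.re h0
      simp at this
      linarith
    rw [hden]
    have : z - b - (z - a) = -2 * w / r := by rw [← hsub]; ring
    rw [this]
    field_simp
    linear_combination Complex.I_sq
  simp_rw [key]
  rw [intervalIntegral.integral_const_mul, i3]
  field_simp
  linear_combination (-1) * Complex.I_sq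

lemma laplace_J0 (p w : ℂ) (r : ℝ) (hr : 0 < r) (hp : 0 < p.re) (hw : 0 < w.re)
    (h : w ^ 2 = p ^ 2 + r ^ 2) :
    ∫ ω in Set.Ioi (0 : ℝ), Complex.exp (-p * ω) * ((J0 (r * ω) : ℝ) : ℂ) = 1 / w := by
  have hsw := intervalIntegral_integral_swap (μ := volume.restrict (Set.Ioi (0 : ℝ)))
    (a := 0) (b := 2 * Real.pi)
    (f := fun φ ω : ℝ => Complex.exp (-p * ω) * Complex.exp (Complex.I * (r * ω : ℝ) * Real.sin φ)) ?_
  · have h1 : ∀ ω : ℝ, Complex.exp (-p * ω) * ((J0 (r * ω) : ℝ) : ℂ) = (1 / (2 * Real.pi) : ℂ) *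
        ∫ φ in (0 : ℝ)..(2 * Real.pi), Complex.exp (-p * ω) * Complex.exp (Complex.I * (r * ω : ℝ) * Real.sin φ) := by
      intro ω
      rw [J0_complex, intervalIntegral.integral_const_mul]
      ring
    simp_rw [h1]
    rw [integral_const_mul, ← hsw]
    have h2 : ∀ φ : ℝ, ∫ ω in Set.Ioi (0 : ℝ), Complex.exp (-p * ω) *
        Complex.exp (Complex.I * (r * ω : ℝ) * Real.sin φ) = 1 / (p - Complex.I * r * Real.sin φ) := by
      intro φ
      have := integral_exp_mul_complex_Ioi (a := -(p - Complex.I * r * Real.sin φ)) (by simpa using hp) 0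
      simp only [Complex.ofReal_zero, mul_zero, Complex.exp_zero, neg_div_neg_eq] at this
      rw [← this]
      congr 1
      ext ω
      rw [← Complex.exp_add]
      congr 1
      push_cast
      ring
    simp_rw [h2]
    rw [contour p w r hr hp hw h]
    have : w ≠ 0 := by rintro rfl; simp at hw
    have : (Real.pi : ℂ) ≠ 0 := by exact_mod_cast Real.pi_ne_zero
    field_simp
  · have hi : Integrable (fun z : ℝ × ℝ => (1 : ℝ) * Real.exp (-p.re * z.2))
        ((volume.restrict (Set.uIoc 0 (2 * Real.pi))).prod (volume.restrict (Set.Ioi (0 : ℝ)))) := by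
      apply Integrable.mul_prod (f := fun _ => (1 : ℝ)) (g := fun x => Real.exp (-p.re * x))
      · rw [Set.uIoc]; exact integrable_const _
      · exact exp_neg_integrableOn_Ioi 0 hp
    refine hi.mono' ?_ ?_
    · apply Continuous.aestronglyMeasurable
      unfold Function.uncurry
      fun_prop
    · refine Filter.Eventually.of_forall fun z => ?_
      simp [Function.uncurry, Complex.norm_exp]

lemma gauss_fourier (ω t : ℝ) : ∫ y : ℝ, ((Real.exp (-(y - t) ^ 2 / 2) : ℝ) : ℂ) * Complex.exp (Complex.I * ω * y)
    = (Real.sqrt (2 * Real.pi) : ℂ) * (((Real.exp (-ω ^ 2 / 2) : ℝ) : ℂ) * Complex.exp (Complex.I * ω * t)) := by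
  have := fourierIntegral_gaussian (b := 1 / 2) (by norm_num) (ω : ℂ)
  rw [← integral_add_right_eq_self _ t]
  have h1 : ∀ y : ℝ, ((Real.exp (-(y + t - t) ^ 2 / 2) : ℝ) : ℂ) * Complex.exp (Complex.I * ω * (y + t : ℝ))
     = Complex.exp (Complex.I * ω * t) * (Complex.exp (Complex.I * ω * y) * Complex.exp (-(1 / 2) * y ^ 2)) := by
    intro y
    push_cast
    rw [← Complex.exp_add, ← Complex.exp_add, ← Complex.exp_add]
    congr 1
    ring
  simp_rw [h1]
  rw [integral_const_mul, this]
  have h2 : ((Real.pi : ℂ) / (1 / 2)) ^ (1 / 2 : ℂ) = (Real.sqrt (2 * Real.pi) : ℂ) := by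
    rw [Real.sqrt_eq_rpow, Complex.ofReal_cpow (by positivity)]
    push_cast
    congr 1
    ring
  rw [h2]
  push_cast
  ring_nf

lemma half_facts (z : ℂ) (hz : 0 < z.re) : (z ^ (1 / 2 : ℂ)) ^ 2 = z ∧
    |(z ^ (1 / 2 : ℂ)).im| < (z ^ (1 / 2 : ℂ)).re := by
  have hz0 : z ≠ 0 := by rintro rfl; simp at hz
  have hsq : (z ^ (1 / 2 : ℂ)) ^ 2 = z := by
    rw [← Complex.cpow_nat_mul]; norm_num
  refine ⟨hsq, ?_⟩
  have hre : 0 ≤ (z ^ (1 / 2 : ℂ)).re := by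
    rw [Complex.cpow_def_of_ne_zero hz0, Complex.exp_re]
    apply mul_nonneg (Real.exp_pos _).le
    have : (Complex.log z * (1 / 2)).im = z.arg / 2 := by
      have : Complex.log z * (1 / 2) = Complex.log z / (2 : ℝ) := by push_cast; ring
      rw [this, Complex.div_ofReal_im, Complex.log_im]
    rw [this]
    have h1 := Complex.neg_pi_lt_arg z
    have h2 := Complex.arg_le_pi z
    exact Real.cos_nonneg_of_neg_pi_div_two_le_of_le (by linarith) (by linarith)
  set u := z ^ (1 / 2 : ℂ)
  have h3 : u.re ^ 2 - u.im ^ 2 = z.re := by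
    rw [← hsq]; simp [pow_two]
  apply abs_lt_of_sq_lt_sq _ hre
  linarith

noncomputable def ww (r ε y : ℝ) : ℂ :=
  ((ε : ℂ) - Complex.I * (y - r)) ^ (1 / 2 : ℂ) * ((ε : ℂ) - Complex.I * (y + r)) ^ (1 / 2 : ℂ)

lemma ww_facts (r ε y : ℝ) (hε : 0 < ε) : 0 < (ww r ε y).re ∧
    (ww r ε y) ^ 2 = ((ε : ℂ) - Complex.I * y) ^ 2 + r ^ 2 := by
  obtain ⟨h1, h2⟩ := half_facts ((ε : ℂ) - Complex.I * (y - r)) (by simpa using hε)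
  obtain ⟨h3, h4⟩ := half_facts ((ε : ℂ) - Complex.I * (y + r)) (by simpa using hε)
  constructor
  · rw [ww, Complex.mul_re]
    have := mul_lt_mul'' h2 h4 (abs_nonneg _) (abs_nonneg _)
    rw [← abs_mul] at this
    linarith [le_abs_self ((((ε : ℂ) - Complex.I * (y - r)) ^ (1 / 2 : ℂ)).im * (((ε : ℂ) - Complex.I * (y + r)) ^ (1 / 2 : ℂ)).im)]
  · rw [ww, mul_pow, h1, h3]
    linear_combination (-(r : ℂ) ^ 2) * Complex.I_sq

lemma gauss_integrable (t : ℝ) : Integrable (fun y : ℝ => Real.exp (-(y - t) ^ 2 / 2)) := by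
  have := (integrable_exp_neg_mul_sq (b := 1 / 2) (by norm_num)).comp_sub_right t
  refine this.congr (Filter.Eventually.of_forall fun y => ?_)
  simp only
  congr 1
  ring

lemma damped (t r ε : ℝ) (hr : 0 < r) (hε : 0 < ε) :
    ∫ ω in Set.Ioi (0 : ℝ), Real.exp (-ε * ω) * (Real.exp (-ω ^ 2 / 2) * Real.sin (ω * t) * J0 (r * ω)) =
    (1 / Real.sqrt (2 * Real.pi)) * ∫ y : ℝ, Real.exp (-(y - t) ^ 2 / 2) * (1 / ww r ε y).im := by
  have hJ := J0_continuous
  set F : ℝ → ℝ → ℂ := fun ω y => ((Real.exp (-(y - t) ^ 2 / 2) : ℝ) : ℂ) *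
    (Complex.exp (-((ε : ℂ) - Complex.I * y) * ω) * ((J0 (r * ω) : ℝ) : ℂ)) with hF
  have hint : Integrable (Function.uncurry F) ((volume.restrict (Set.Ioi (0 : ℝ))).prod volume) := by
    have := Integrable.mul_prod (exp_neg_integrableOn_Ioi 0 hε) (gauss_integrable t)
    refine Integrable.mono' this ?_ ?_
    · apply Continuous.aestronglyMeasurable
      unfold Function.uncurry
      simp only [hF]
      fun_prop
    · refine Filter.Eventually.of_forall fun z => ?_
      simp only [Function.uncurry, hF, norm_mul, Complex.norm_exp, Complex.norm_real, Real.norm_eq_abs, Real.abs_exp]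
      have h1 : (-((ε : ℂ) - Complex.I * z.2) * z.1).re = -ε * z.1 := by simp
      rw [h1, mul_comm]
      gcongr
      calc _ ≤ Real.exp (-ε * z.1) * 1 := by gcongr; exact J0_abs_le _
        _ = _ := mul_one _
  have hsw := integral_integral_swap hint
  have hin : ∀ ω : ℝ, ∫ y, F ω y = (Real.sqrt (2 * Real.pi) : ℂ) * (Complex.exp (-ε * ω) *
      (((Real.exp (-ω ^ 2 / 2) : ℝ) : ℂ) * Complex.exp (Complex.I * ω * t) * ((J0 (r * ω) : ℝ) : ℂ))) := by
    intro ω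
    have h1 : ∀ y, F ω y = (Complex.exp (-ε * ω) * ((J0 (r * ω) : ℝ) : ℂ)) * 
       (((Real.exp (-(y - t) ^ 2 / 2) : ℝ) : ℂ) * Complex.exp (Complex.I * ω * y)) := by
      intro y
      have : -((ε : ℂ) - Complex.I * y) * ω = -ε * ω + Complex.I * ω * y := by ring
      simp only [hF]
      rw [this, Complex.exp_add]
      ring
    simp_rw [h1]
    rw [integral_const_mul, gauss_fourier]
    ring
  have hout : ∀ y : ℝ, ∫ ω in Set.Ioi (0 : ℝ), F ω y = 
      ((Real.exp (-(y - t) ^ 2 / 2) : ℝ) : ℂ) * (1 / ww r ε y) := by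
    intro y
    obtain ⟨h1, h2⟩ := ww_facts r ε y hε
    simp only [hF]
    rw [integral_const_mul, laplace_J0 _ (ww r ε y) r hr (by simpa using hε) h1 h2]
  have hi1 := hint.integral_prod_left
  have hi2 := hint.integral_prod_right
  simp only [Function.uncurry] at hi1 hi2
  have him1 := Complex.imCLM.integral_comp_comm hi1
  have him2 := Complex.imCLM.integral_comp_comm hi2
  rw [hsw, ← him2] at him1
  simp_rw [hin, hout] at him1
  simp only [Complex.imCLM_apply, Complex.im_ofReal_mul] at him1
  rw [← him1, integral_const_mul, ← mul_assoc]
  have : 1 / Real.sqrt (2 * Real.pi) * Real.sqrt (2 * Real.pi) = 1 := by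
    have : Real.sqrt (2 * Real.pi) ≠ 0 := by positivity
    field_simp
  rw [this, one_mul]
  congr 1
  ext ω
  have e1 : Complex.exp (-ε * ω) = ((Real.exp (-ε * ω) : ℝ) : ℂ) := by push_cast; rfl
  have e2 : Complex.I * ω * t = ((ω * t : ℝ) : ℂ) * Complex.I := by push_cast; ring
  rw [e1, Complex.im_ofReal_mul, Complex.im_mul_ofReal, Complex.im_ofReal_mul, e2, Complex.exp_ofReal_mul_I_im]

lemma lhs_limit (t r : ℝ) :
    Filter.Tendsto (fun ε : ℝ => ∫ ω in Set.Ioi (0 : ℝ), Real.exp (-ε * ω) * (Real.exp (-ω ^ 2 / 2) * Real.sin (ω * t) * J0 (r * ω)))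
    (nhdsWithin 0 (Set.Ioi 0)) (nhds (∫ ω in Set.Ioi (0 : ℝ), (Real.exp (-ω ^ 2 / 2) * Real.sin (ω * t) * J0 (r * ω)))) := by
  have hJ := J0_continuous
  apply tendsto_integral_filter_of_dominated_convergence (fun ω => Real.exp (-(ω - 0) ^ 2 / 2))
  · refine Filter.Eventually.of_forall fun ε => ?_
    apply Continuous.aestronglyMeasurable
    fun_prop
  · filter_upwards [self_mem_nhdsWithin] with ε hε
    filter_upwards [ae_restrict_mem measurableSet_Ioi] with ω hω
    have hε' : 0 < ε := hε
    have hω' : 0 < ω := hω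
    rw [norm_mul, norm_mul, norm_mul]
    simp only [Real.norm_eq_abs, Real.abs_exp, sub_zero]
    have h1 : Real.exp (-ε * ω) ≤ 1 := by
      rw [Real.exp_le_one_iff]; nlinarith [mul_pos hε' hω']
    calc _ ≤ 1 * (Real.exp (-ω ^ 2 / 2) * 1 * 1) := by
          gcongr
          · exact Real.abs_sin_le_one _
          · exact J0_abs_le _
      _ = _ := by ring
  · exact (gauss_integrable 0).integrableOn
  · refine Filter.Eventually.of_forall fun ω => ?_
    have : Continuous fun ε : ℝ => Real.exp (-ε * ω) * (Real.exp (-ω ^ 2 / 2) * Real.sin (ω * t) * J0 (r * ω)) := by fun_prop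
    have h := this.tendsto 0
    simp only [neg_zero, zero_mul, Real.exp_zero, one_mul] at h
    exact h.mono_left nhdsWithin_le_nhds

lemma base_integrable : Integrable (fun x : ℝ => |x| ^ (-1 / 2 : ℝ) * Real.exp (-(1 / 4) * x ^ 2)) := by
  have h0 : IntegrableOn (fun x : ℝ => |x| ^ (-1 / 2 : ℝ) * Real.exp (-(1 / 4) * x ^ 2)) (Set.Ioi 0) := by
    refine (integrableOn_rpow_mul_exp_neg_mul_sq (b := 1 / 4) (by norm_num) (s := -1 / 2) (by norm_num)).congr_fun
      (fun x hx => ?_) measurableSet_Ioi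
    have hx' : 0 < x := hx
    simp only [abs_of_pos hx']
  have h1 : IntegrableOn (fun x : ℝ => |x| ^ (-1 / 2 : ℝ) * Real.exp (-(1 / 4) * x ^ 2)) (Set.Iic 0) := by
    have := (integrableOn_Iic_iff_integrableOn_Iio (b := (0 : ℝ)) (μ := volume)
      (f := fun x : ℝ => |x| ^ (-1 / 2 : ℝ) * Real.exp (-(1 / 4) * x ^ 2)))
    rw [this]
    have h2 := (Measure.measurePreserving_neg (volume : Measure ℝ)).integrableOn_comp_preimage
      (Homeomorph.neg ℝ).measurableEmbedding (f := fun x : ℝ => |x| ^ (-1 / 2 : ℝ) * Real.exp (-(1 / 4) * x ^ 2))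
      (s := Set.Ioi 0)
    have h3 := h2.2 h0
    simpa [Function.comp_def] using h3
  rw [← integrableOn_univ, ← Set.Iic_union_Ioi (a := (0 : ℝ))]
  exact h1.union h0

lemma sing_integrable (t c : ℝ) : Integrable (fun y : ℝ => Real.exp (-(y - t) ^ 2 / 2) * |y - c| ^ (-1 / 2 : ℝ)) := by
  have h : Integrable (fun y : ℝ => Real.exp (-(y - (t - c)) ^ 2 / 2) * |y| ^ (-1 / 2 : ℝ)) := by
    refine Integrable.mono' (base_integrable.const_mul (Real.exp ((t - c) ^ 2 / 2))) ?_ ?_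
    · apply Measurable.aestronglyMeasurable
      fun_prop
    · refine Filter.Eventually.of_forall fun y => ?_
      rw [Real.norm_of_nonneg (by positivity), mul_comm, mul_left_comm, ← Real.exp_add]
      gcongr
      nlinarith [sq_nonneg (y / 2 - (t - c))]
  refine (h.comp_sub_right c).congr (Filter.Eventually.of_forall fun y => ?_)
  simp only
  congr 3
  ring

lemma norm_half_ge (ε x : ℝ) : |x| ^ (1 / 2 : ℝ) ≤ ‖((ε : ℂ) - Complex.I * x) ^ (1 / 2 : ℂ)‖ := by
  have : (1 / 2 : ℂ) = ((1 / 2 : ℝ) : ℂ) := by push_cast; rfl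
  rw [this, Complex.norm_cpow_real]
  gcongr
  have := Complex.abs_im_le_norm ((ε : ℂ) - Complex.I * x)
  simpa using this

lemma ww_bound (r ε y : ℝ) (hr : 0 < r) (h1 : y - r ≠ 0) (h2 : y + r ≠ 0) :
    ‖1 / ww r ε y‖ ≤ r ^ (-1 / 2 : ℝ) * (|y - r| ^ (-1 / 2 : ℝ) + |y - (-r)| ^ (-1 / 2 : ℝ)) := by
  have e1 := norm_half_ge ε (y - r)
  have e2 := norm_half_ge ε (y + r)
  have p1 : 0 < |y - r| := abs_pos.2 h1
  have p2 : 0 < |y + r| := abs_pos.2 h2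
  have hneg : ∀ x : ℝ, 0 ≤ x → x ^ (-1 / 2 : ℝ) = 1 / x ^ (1 / 2 : ℝ) := by
    intro x hx
    rw [neg_div, Real.rpow_neg hx, one_div (x ^ _)]
  have s1 : ‖1 / ww r ε y‖ ≤ |y - r| ^ (-1 / 2 : ℝ) * |y + r| ^ (-1 / 2 : ℝ) := by
    rw [hneg _ p1.le, hneg _ p2.le, ww, norm_div, norm_mul, norm_one, div_mul_div_comm, one_mul]
    push_cast at e1 e2
    gcongr
  refine s1.trans ?_
  rw [sub_neg_eq_add]
  have hA : 0 ≤ |y - r| ^ (-1 / 2 : ℝ) := by positivity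
  have hB : 0 ≤ |y + r| ^ (-1 / 2 : ℝ) := by positivity
  have hR : 0 ≤ r ^ (-1 / 2 : ℝ) := by positivity
  have hmax : r ≤ |y - r| ∨ r ≤ |y + r| := by
    rcases le_total 0 y with h | h
    · right; rw [abs_of_nonneg (by linarith)]; linarith
    · left; rw [abs_of_nonpos (by linarith)]; linarith
  rcases hmax with h | h
  · have : |y - r| ^ (-1 / 2 : ℝ) ≤ r ^ (-1 / 2 : ℝ) := Real.rpow_le_rpow_of_nonpos hr h (by norm_num)
    nlinarith [mul_nonneg hR hA, mul_le_mul_of_nonneg_right this hB]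
  · have : |y + r| ^ (-1 / 2 : ℝ) ≤ r ^ (-1 / 2 : ℝ) := Real.rpow_le_rpow_of_nonpos hr h (by norm_num)
    nlinarith [mul_nonneg hR hB, mul_le_mul_of_nonneg_left this hA]

lemma halfpow_pos (x : ℝ) (hx : 0 < x) : ((0 : ℂ) - Complex.I * x) ^ (1 / 2 : ℂ) =
    (Real.sqrt x : ℂ) * Complex.exp (-(Real.pi / 4) * Complex.I) := by
  have e : (0 : ℂ) - Complex.I * x = x * (-Complex.I) := by ring
  rw [e, Complex.cpow_def_of_ne_zero (by simp [hx.ne']), Complex.log_ofReal_mul hx (by simp),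
    Complex.log_neg_I, Real.sqrt_eq_rpow, Real.rpow_def_of_pos hx, Complex.ofReal_exp, ← Complex.exp_add]
  congr 1
  push_cast
  ring

lemma halfpow_neg (x : ℝ) (hx : x < 0) : ((0 : ℂ) - Complex.I * x) ^ (1 / 2 : ℂ) =
    (Real.sqrt (-x) : ℂ) * Complex.exp ((Real.pi / 4) * Complex.I) := by
  have e : (0 : ℂ) - Complex.I * x = (-x : ℝ) * (Complex.I) := by push_cast; ring
  have hx' : 0 < -x := by linarith
  rw [e, Complex.cpow_def_of_ne_zero (by simp [hx.ne]), Complex.log_ofReal_mul hx' (by simp),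
    Complex.log_I, Real.sqrt_eq_rpow, Real.rpow_def_of_pos hx', Complex.ofReal_exp, ← Complex.exp_add]
  congr 1
  push_cast
  ring

lemma ww0_gt (r y : ℝ) (hr : 0 < r) (h : r < y) :
    (1 / ww r 0 y).im = 1 / (Real.sqrt (y - r) * Real.sqrt (y + r)) := by
  have h1 := halfpow_pos (y - r) (by linarith)
  have h2 := halfpow_pos (y + r) (by linarith)
  push_cast at h1 h2
  rw [ww, Complex.ofReal_zero, h1, h2]
  have : (Real.sqrt (y - r) : ℂ) * Complex.exp (-(Real.pi / 4) * Complex.I) *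
     ((Real.sqrt (y + r) : ℂ) * Complex.exp (-(Real.pi / 4) * Complex.I)) =
     ((Real.sqrt (y - r) * Real.sqrt (y + r) : ℝ) : ℂ) * (-Complex.I) := by
    have : Complex.exp (-(Real.pi / 4) * Complex.I) * Complex.exp (-(Real.pi / 4) * Complex.I) = -Complex.I := by
      have e : -(Real.pi / 4) * Complex.I + -(Real.pi / 4) * Complex.I = -Real.pi / 2 * Complex.I := by ring
      rw [← Complex.exp_add, e, Complex.exp_neg_pi_div_two_mul_I]
    push_cast
    linear_combination ((Real.sqrt (y - r) : ℂ) * (Real.sqrt (y + r) : ℂ)) * this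
  rw [this, one_div, mul_inv, ← Complex.ofReal_inv, Complex.im_ofReal_mul]
  simp

lemma ww0_lt (r y : ℝ) (hr : 0 < r) (h : y < -r) :
    (1 / ww r 0 y).im = -(1 / (Real.sqrt (-y - r) * Real.sqrt (-y + r))) := by
  have h1 := halfpow_neg (y - r) (by linarith)
  have h2 := halfpow_neg (y + r) (by linarith)
  have a1 : -(y - r) = -y + r := by ring
  have a2 : -(y + r) = -y - r := by ring
  rw [a1] at h1
  rw [a2] at h2
  push_cast at h1 h2
  rw [ww, Complex.ofReal_zero, h1, h2]
  have : (Real.sqrt (-y + r) : ℂ) * Complex.exp ((Real.pi / 4) * Complex.I) *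
     ((Real.sqrt (-y - r) : ℂ) * Complex.exp ((Real.pi / 4) * Complex.I)) =
     ((Real.sqrt (-y - r) * Real.sqrt (-y + r) : ℝ) : ℂ) * (Complex.I) := by
    have : Complex.exp ((Real.pi / 4) * Complex.I) * Complex.exp ((Real.pi / 4) * Complex.I) = Complex.I := by
      have e : (Real.pi / 4) * Complex.I + (Real.pi / 4) * Complex.I = Real.pi / 2 * Complex.I := by ring
      rw [← Complex.exp_add, e, Complex.exp_pi_div_two_mul_I]
    push_cast
    linear_combination ((Real.sqrt (-y - r) : ℂ) * (Real.sqrt (-y + r) : ℂ)) * this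
  rw [this, one_div, mul_inv, ← Complex.ofReal_inv, Complex.im_ofReal_mul]
  simp

lemma ww0_mid (r y : ℝ) (h : -r < y) (h' : y < r) : (1 / ww r 0 y).im = 0 := by
  have h1 := halfpow_neg (y - r) (by linarith)
  have h2 := halfpow_pos (y + r) (by linarith)
  push_cast at h1 h2
  rw [ww, Complex.ofReal_zero, h1, h2]
  have : (Real.sqrt (-(y - r)) : ℂ) * Complex.exp ((Real.pi / 4) * Complex.I) *
     ((Real.sqrt (y + r) : ℂ) * Complex.exp (-(Real.pi / 4) * Complex.I)) =
     ((Real.sqrt (-(y - r)) * Real.sqrt (y + r) : ℝ) : ℂ) := by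
    have : Complex.exp ((Real.pi / 4) * Complex.I) * Complex.exp (-(Real.pi / 4) * Complex.I) = 1 := by
      rw [← Complex.exp_add]; simp
    push_cast
    linear_combination ((Real.sqrt (-(y - r)) : ℂ) * (Real.sqrt (y + r) : ℂ)) * this
  push_cast at this ⊢
  rw [this, ← Complex.ofReal_mul, one_div, ← Complex.ofReal_inv, Complex.ofReal_im]

lemma half_cont (x : ℝ) (hx : x ≠ 0) :
    ContinuousAt (fun ε : ℝ => ((ε : ℂ) - Complex.I * x) ^ (1 / 2 : ℂ)) 0 := by
  refine ContinuousAt.cpow ?_ continuousAt_const ?_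
  · fun_prop
  · rw [Complex.mem_slitPlane_iff]
    right
    simpa using hx

lemma ww_tendsto (r y : ℝ) (h1 : y - r ≠ 0) (h2 : y + r ≠ 0) :
    Filter.Tendsto (fun ε : ℝ => (1 / ww r ε y).im) (nhdsWithin 0 (Set.Ioi 0)) (nhds (1 / ww r 0 y).im) := by
  have c1 := half_cont _ h1
  have c2 := half_cont _ h2
  push_cast at c1 c2
  have n1 := norm_half_ge 0 (y - r)
  have n2 := norm_half_ge 0 (y + r)
  push_cast at n1 n2
  have p1 : 0 < |y - r| ^ (1 / 2 : ℝ) := Real.rpow_pos_of_pos (abs_pos.2 h1) _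
  have p2 : 0 < |y + r| ^ (1 / 2 : ℝ) := Real.rpow_pos_of_pos (abs_pos.2 h2) _
  have hne : ww r 0 y ≠ 0 := by
    rw [ww]
    push_cast
    exact mul_ne_zero (norm_pos_iff.1 (p1.trans_le n1)) (norm_pos_iff.1 (p2.trans_le n2))
  have hc : ContinuousAt (fun ε : ℝ => ww r ε y) 0 := c1.mul c2
  have hc' : ContinuousAt (fun ε : ℝ => (1 / ww r ε y).im) 0 :=
    Complex.continuous_im.continuousAt.comp (continuousAt_const.div hc hne)
  exact hc'.tendsto.mono_left nhdsWithin_le_nhds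

lemma ww_meas (r ε : ℝ) : Measurable (fun y : ℝ => (1 / ww r ε y).im) := by
  unfold ww
  fun_prop

lemma ae_ne (r : ℝ) : ∀ᵐ y : ℝ, y - r ≠ 0 ∧ y + r ≠ 0 := by
  filter_upwards [Measure.ae_ne volume r, Measure.ae_ne volume (-r)] with y h1 h2
  exact ⟨sub_ne_zero.2 h1, fun h => h2 (by linarith)⟩

lemma bound_integrable (t r : ℝ) : Integrable (fun y : ℝ => Real.exp (-(y - t) ^ 2 / 2) *
    (r ^ (-1 / 2 : ℝ) * (|y - r| ^ (-1 / 2 : ℝ) + |y - (-r)| ^ (-1 / 2 : ℝ)))) := by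
  refine (((sing_integrable t r).add (sing_integrable t (-r))).const_mul (r ^ (-1 / 2 : ℝ))).congr
    (Filter.Eventually.of_forall fun y => ?_)
  simp only [Pi.add_apply]
  ring

lemma integrand_bound (t r ε : ℝ) (hr : 0 < r) : ∀ᵐ y : ℝ,
    ‖Real.exp (-(y - t) ^ 2 / 2) * (1 / ww r ε y).im‖ ≤ Real.exp (-(y - t) ^ 2 / 2) *
    (r ^ (-1 / 2 : ℝ) * (|y - r| ^ (-1 / 2 : ℝ) + |y - (-r)| ^ (-1 / 2 : ℝ))) := by
  filter_upwards [ae_ne r] with y hy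
  rw [norm_mul, Real.norm_eq_abs, Real.abs_exp, Real.norm_eq_abs]
  gcongr
  exact (Complex.abs_im_le_norm _).trans (ww_bound r ε y hr hy.1 hy.2)

lemma integrand_meas (t r ε : ℝ) : AEStronglyMeasurable
    (fun y : ℝ => Real.exp (-(y - t) ^ 2 / 2) * (1 / ww r ε y).im) := by
  have := ww_meas r ε
  apply Measurable.aestronglyMeasurable
  exact Measurable.mul (by fun_prop) this

lemma rhs_limit (t r : ℝ) (hr : 0 < r) :
    Filter.Tendsto (fun ε : ℝ => ∫ y : ℝ, Real.exp (-(y - t) ^ 2 / 2) * (1 / ww r ε y).im)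
    (nhdsWithin 0 (Set.Ioi 0)) (nhds (∫ y : ℝ, Real.exp (-(y - t) ^ 2 / 2) * (1 / ww r 0 y).im)) := by
  apply tendsto_integral_filter_of_dominated_convergence _ _ _ (bound_integrable t r)
  · filter_upwards [ae_ne r] with y hy
    exact (ww_tendsto r y hy.1 hy.2).const_mul _
  · exact Filter.Eventually.of_forall fun ε => integrand_meas t r ε
  · exact Filter.Eventually.of_forall fun ε => integrand_bound t r ε hr

lemma change_var (s r : ℝ) (hr : 0 < r) :
    ∫ y in Set.Ioi r, Real.exp (-(y - s) ^ 2 / 2) * (1 / (Real.sqrt (y - r) * Real.sqrt (y + r))) =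
    ∫ ξ in Set.Ioi (0 : ℝ),
      1 / (Real.sqrt ξ * Real.sqrt (ξ + 2)) * Real.exp (-(r - s + ξ * r) ^ 2 / 2) := by
  have h1 := (measurePreserving_add_right (volume : Measure ℝ) r).setIntegral_preimage_emb
    (Homeomorph.addRight r).measurableEmbedding
    (fun y => Real.exp (-(y - s) ^ 2 / 2) * (1 / (Real.sqrt (y - r) * Real.sqrt (y + r)))) (Set.Ioi r)
  rw [← h1]
  have h2 : (fun x => x + r) ⁻¹' Set.Ioi r = Set.Ioi 0 := by
    ext x; simp
  rw [h2]
  have h3 := integral_comp_mul_left_Ioi (fun x => Real.exp (-(x + r - s) ^ 2 / 2) * (1 / (Real.sqrt (x + r - r) * Real.sqrt (x + r + r)))) 0 hr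
  rw [mul_zero, smul_eq_mul] at h3
  have h4 : ∀ a b : ℝ, a = r⁻¹ * b → b = r * a := by
    intro a b h
    rw [h]; field_simp
  rw [h4 _ _ h3, ← integral_const_mul]
  apply setIntegral_congr_fun measurableSet_Ioi
  intro ξ hξ
  have hξ' : 0 < ξ := hξ
  simp only
  have e1 : r * ξ + r - r = r * ξ := by ring
  have e2 : r * ξ + r + r = r * (ξ + 2) := by ring
  have e3 : r * ξ + r - s = r - s + ξ * r := by ring
  rw [e1, e2, e3, Real.sqrt_mul hr.le, Real.sqrt_mul hr.le]
  have e4 : Real.sqrt r * Real.sqrt ξ * (Real.sqrt r * Real.sqrt (ξ + 2)) = r * (Real.sqrt ξ * Real.sqrt (ξ + 2)) := by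
    rw [mul_mul_mul_comm, Real.mul_self_sqrt hr.le]
  rw [e4]
  have : 0 < Real.sqrt ξ := Real.sqrt_pos.2 hξ'
  have : 0 < Real.sqrt (ξ + 2) := Real.sqrt_pos.2 (by linarith)
  field_simp

lemma final_integral (t r : ℝ) (hr : 0 < r) :
    (1 / Real.sqrt (2 * Real.pi)) * (∫ y : ℝ, Real.exp (-(y - t) ^ 2 / 2) * (1 / ww r 0 y).im) =
    Wtilde t r - Wtilde (-t) r := by
  have hi : Integrable (fun y : ℝ => Real.exp (-(y - t) ^ 2 / 2) * (1 / ww r 0 y).im) :=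
    (bound_integrable t r).mono' (integrand_meas t r 0) (integrand_bound t r 0 hr)
  rw [Wtilde, Wtilde, ← mul_sub, ← change_var t r hr, ← change_var (-t) r hr]
  congr 1
  rw [← intervalIntegral.integral_Iic_add_Ioi (b := r) hi.integrableOn hi.integrableOn]
  have hs : Set.Iic r = Set.Iic (-r) ∪ Set.Ioc (-r) r := by
    rw [Set.Iic_union_Ioc_eq_Iic (by linarith)]
  rw [hs, setIntegral_union (Set.Iic_disjoint_Ioc le_rfl) measurableSet_Ioc hi.integrableOn hi.integrableOn]
  have m : ∫ y in Set.Ioc (-r) r, Real.exp (-(y - t) ^ 2 / 2) * (1 / ww r 0 y).im = 0 := by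
    rw [integral_Ioc_eq_integral_Ioo]
    apply setIntegral_eq_zero_of_forall_eq_zero
    intro y hy
    rw [ww0_mid r y hy.1 hy.2, mul_zero]
  have u : ∫ y in Set.Ioi r, Real.exp (-(y - t) ^ 2 / 2) * (1 / ww r 0 y).im =
      ∫ y in Set.Ioi r, Real.exp (-(y - t) ^ 2 / 2) * (1 / (Real.sqrt (y - r) * Real.sqrt (y + r))) := by
    apply setIntegral_congr_fun measurableSet_Ioi
    intro y hy
    simp only
    rw [ww0_gt r y hr hy]
  have l : ∫ y in Set.Iic (-r), Real.exp (-(y - t) ^ 2 / 2) * (1 / ww r 0 y).im =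
      -∫ y in Set.Ioi r, Real.exp (-(y - -t) ^ 2 / 2) * (1 / (Real.sqrt (y - r) * Real.sqrt (y + r))) := by
    have := integral_comp_neg_Iic (-r) (fun y => Real.exp (-(y - -t) ^ 2 / 2) * (1 / (Real.sqrt (y - r) * Real.sqrt (y + r))))
    rw [neg_neg] at this
    rw [← this, ← integral_neg, integral_Iic_eq_integral_Iio, integral_Iic_eq_integral_Iio]
    apply setIntegral_congr_fun measurableSet_Iio
    intro y hy
    simp only
    rw [ww0_lt r y hr hy]
    have : (-y - -t) ^ 2 = (y - t) ^ 2 := by ring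
    rw [this]
    ring
  rw [m, u, l]
  ring

theorem stmt_10 (t r : ℝ) (ht : 0 ≤ t) (hr : 0 < r) :
    (∫ ω in Set.Ioi (0 : ℝ), Real.exp (-ω ^ 2 / 2) * Real.sin (ω * t) * J0 (r * ω)) =
      Wtilde t r - Wtilde (-t) r := by
  rw [← final_integral t r hr]
  refine tendsto_nhds_unique (lhs_limit t r) (((rhs_limit t r hr).const_mul _).congr' ?_)
  filter_upwards [self_mem_nhdsWithin] with ε hε
  exact (damped t r ε hr hε).symm
end

section
/- For every real t ≥ 0 and r ≥ 0 there holds ∫₀^∞ ω e^{−ω²/2} J₀(rω) cos(tω) dω = 𝒥_{0,1}(t,r) − t² 𝒥_{0,3}(t,r) + r t 𝒥_{1,2}(t,r), where 𝒥_{j,n}(t,r) = ∫₀^1 exp(−(r−t+tξ)²/2) · Ĩⱼ(rt(1−ξ)) · (1−ξ)ⁿ / (√ξ · √(2−ξ)) dξ. -/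
open MeasureTheory

/-- Modified Bessel function of the first kind of integer order `j`:
`Iⱼ(z) = (1/π)∫₀^π e^{z cos φ} cos(jφ) dφ`. -/
noncomputable def besselI (j : ℕ) (z : ℝ) : ℝ :=
  (1 / Real.pi) * ∫ φ in (0 : ℝ)..Real.pi, Real.exp (z * Real.cos φ) * Real.cos (j * φ)

/-- `Ĩⱼ(z) = e^{−z} Iⱼ(z)`. -/
noncomputable def Itilde (j : ℕ) (z : ℝ) : ℝ := Real.exp (-z) * besselI j z

/-- `𝒥_{j,n}(t,r) = ∫₀^1 exp(−(r−t+tξ)²/2) Ĩⱼ(rt(1−ξ)) (1−ξ)ⁿ / (√ξ √(2−ξ)) dξ`. -/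
noncomputable def Jjn (j n : ℕ) (t r : ℝ) : ℝ :=
  ∫ ξ in (0 : ℝ)..1,
    Real.exp (-(r - t + t * ξ) ^ 2 / 2) * Itilde j (r * t * (1 - ξ)) * (1 - ξ) ^ n /
      (Real.sqrt ξ * Real.sqrt (2 - ξ))


open Real Set

lemma gE_int : Integrable (fun x : ℝ => exp (-x ^ 2 / 2)) := by
  have := integrable_exp_neg_mul_sq (b := 1/2) (by norm_num)
  refine this.congr (Filter.Eventually.of_forall fun x => ?_)
  simp only
  congr 1; ring

lemma gxE_int : Integrable (fun x : ℝ => x * exp (-x ^ 2 / 2)) := by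
  have := integrable_mul_exp_neg_mul_sq (b := 1/2) (by norm_num)
  refine this.congr (Filter.Eventually.of_forall fun x => ?_)
  simp only
  congr 2; ring

lemma int_mul_bdd {f g : ℝ → ℝ} (hf : Integrable f) (hg : Continuous g) (h : ∀ x, |g x| ≤ 1) :
    Integrable (fun x => f x * g x) :=
  hf.mul_bdd (c := 1) hg.aestronglyMeasurable (Filter.Eventually.of_forall (fun x => by simpa using h x))

lemma gEc (a : ℝ) : Integrable (fun x : ℝ => exp (-x ^ 2 / 2) * cos (a * x)) :=
  int_mul_bdd gE_int (by fun_prop) (fun x => abs_cos_le_one _)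
lemma gEs (a : ℝ) : Integrable (fun x : ℝ => exp (-x ^ 2 / 2) * sin (a * x)) :=
  int_mul_bdd gE_int (by fun_prop) (fun x => abs_sin_le_one _)
lemma gxEc (a : ℝ) : Integrable (fun x : ℝ => x * exp (-x ^ 2 / 2) * cos (a * x)) :=
  int_mul_bdd gxE_int (by fun_prop) (fun x => abs_cos_le_one _)
lemma gxEs (a : ℝ) : Integrable (fun x : ℝ => x * exp (-x ^ 2 / 2) * sin (a * x)) :=
  int_mul_bdd gxE_int (by fun_prop) (fun x => abs_sin_le_one _)

lemma int_odd {f : ℝ → ℝ} (h : ∀ x, f (-x) = - f x) : ∫ x, f x = 0 := by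
  have h1 := integral_neg_eq_self f volume
  simp only [h, integral_neg] at h1
  linarith

lemma vEs (a : ℝ) : ∫ x : ℝ, exp (-x ^ 2 / 2) * sin (a * x) = 0 :=
  int_odd (fun x => by simp)
lemma vxEc (a : ℝ) : ∫ x : ℝ, x * exp (-x ^ 2 / 2) * cos (a * x) = 0 :=
  int_odd (fun x => by simp)

lemma vEc (a : ℝ) : ∫ x : ℝ, exp (-x ^ 2 / 2) * cos (a * x) = √(2 * π) * exp (-a ^ 2 / 2) := by
  have h := fourierIntegral_gaussian (b := 1/2) (by norm_num) (a : ℂ)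
  have h2 : (∫ x : ℝ, Complex.exp (Complex.I * a * x) * Complex.exp (-(1/2) * x ^ 2)).re
      = ∫ x : ℝ, exp (-x ^ 2 / 2) * cos (a * x) := by
    rw [← RCLike.re_eq_complex_re, ← integral_re]
    · refine integral_congr_ae (Filter.Eventually.of_forall fun x => ?_)
      simp only [RCLike.re_eq_complex_re]
      have e1 : Complex.exp (-(1/2) * (x:ℂ) ^ 2) = ((exp (-x ^ 2 / 2) : ℝ) : ℂ) := by
        push_cast; congr 1; ring
      have e2 : Complex.I * a * x = ((a * x : ℝ) : ℂ) * Complex.I := by push_cast; ring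
      rw [e1, e2, Complex.re_mul_ofReal, Complex.exp_ofReal_mul_I_re, mul_comm]
    · have := (integrable_cexp_quadratic (b := 1/2) (by norm_num) (Complex.I * a) 0)
      refine this.congr (Filter.Eventually.of_forall fun x => ?_)
      simp only [← Complex.exp_add]
      congr 1; ring
  rw [← h2, h]
  have e3 : ((π : ℂ) / (1/2)) ^ (1 / 2 : ℂ) = ((√(2 * π) : ℝ) : ℂ) := by
    rw [Real.sqrt_eq_rpow, Complex.ofReal_cpow (by positivity)]
    push_cast
    congr 1; ring
  have e4 : Complex.exp (-(a:ℂ) ^ 2 / (4 * (1/2))) = ((exp (-a ^ 2 / 2) : ℝ) : ℂ) := by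
    push_cast; congr 1; ring
  rw [e3, e4, ← Complex.ofReal_mul, Complex.ofReal_re]

lemma vxEs (a : ℝ) :
    ∫ x : ℝ, x * exp (-x ^ 2 / 2) * sin (a * x) = a * (√(2 * π) * exp (-a ^ 2 / 2)) := by
  have hd : ∀ x : ℝ, HasDerivAt (fun x : ℝ => exp (-x ^ 2 / 2) * sin (a * x))
      (a * (exp (-x ^ 2 / 2) * cos (a * x)) - x * exp (-x ^ 2 / 2) * sin (a * x)) x := by
    intro x
    have h1 : HasDerivAt (fun x : ℝ => exp (-x ^ 2 / 2)) (exp (-x ^ 2 / 2) * (-x)) x := by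
      have h0 : HasDerivAt (fun x : ℝ => -x ^ 2 / 2) (-x) x := by
        have := ((hasDerivAt_pow 2 x).fun_neg).div_const 2
        refine this.congr_deriv ?_
        norm_num
        ring
      exact h0.exp
    have h2 : HasDerivAt (fun x : ℝ => sin (a * x)) (cos (a * x) * a) x := by
      have := ((hasDerivAt_id x).const_mul a).sin
      simpa using this
    refine (h1.fun_mul h2).congr_deriv ?_
    ring
  have h := integral_eq_zero_of_hasDerivAt_of_integrable hd
    (((gEc a).const_mul a).sub (gxEs a)) (gEs a)
  rw [integral_sub ((gEc a).const_mul a) (gxEs a), integral_const_mul, vEc] at h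
  linarith

lemma P2 (a b : ℝ) : Integrable (fun k : ℝ × ℝ => exp (-k.1 ^ 2 / 2) * exp (-k.2 ^ 2 / 2) *
      cos (a * k.1 + b * k.2)) ∧
    ∫ k : ℝ × ℝ, exp (-k.1 ^ 2 / 2) * exp (-k.2 ^ 2 / 2) * cos (a * k.1 + b * k.2)
      = 2 * π * exp (-(a ^ 2 + b ^ 2) / 2) := by
  have i1 := (gEc a).mul_prod (gEc b)
  have i2 := (gEs a).mul_prod (gEs b)
  have e : (fun k : ℝ × ℝ => exp (-k.1 ^ 2 / 2) * exp (-k.2 ^ 2 / 2) *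
      cos (a * k.1 + b * k.2)) = fun k : ℝ × ℝ =>
      (exp (-k.1 ^ 2 / 2) * cos (a * k.1)) * (exp (-k.2 ^ 2 / 2) * cos (b * k.2)) -
      (exp (-k.1 ^ 2 / 2) * sin (a * k.1)) * (exp (-k.2 ^ 2 / 2) * sin (b * k.2)) := by
    funext k; rw [cos_add]; ring
  rw [e, Measure.volume_eq_prod]
  refine ⟨i1.sub' i2, ?_⟩
  rw [integral_sub i1 i2]
  erw [integral_prod_mul (fun x : ℝ => exp (-x ^ 2 / 2) * cos (a * x))
    (fun x : ℝ => exp (-x ^ 2 / 2) * cos (b * x)),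
    integral_prod_mul (fun x : ℝ => exp (-x ^ 2 / 2) * sin (a * x))
    (fun x : ℝ => exp (-x ^ 2 / 2) * sin (b * x))]
  rw [vEc, vEc, vEs, vEs]
  have : exp (-(a ^ 2 + b ^ 2) / 2) = exp (-a ^ 2 / 2) * exp (-b ^ 2 / 2) := by
    rw [← exp_add]; congr 1; ring
  rw [this]
  have h := Real.mul_self_sqrt (show 0 ≤ 2 * π by positivity)
  linear_combination (exp (-a ^ 2 / 2) * exp (-b ^ 2 / 2)) * h

lemma Q2 (p q a b : ℝ) : Integrable (fun k : ℝ × ℝ => exp (-k.1 ^ 2 / 2) * exp (-k.2 ^ 2 / 2) *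
      ((p * k.1 + q * k.2) * sin (a * k.1 + b * k.2))) ∧
    ∫ k : ℝ × ℝ, exp (-k.1 ^ 2 / 2) * exp (-k.2 ^ 2 / 2) *
      ((p * k.1 + q * k.2) * sin (a * k.1 + b * k.2))
      = 2 * π * (p * a + q * b) * exp (-(a ^ 2 + b ^ 2) / 2) := by
  have i1 := ((gxEs a).mul_prod (gEc b)).const_mul p
  have i2 := ((gxEc a).mul_prod (gEs b)).const_mul p
  have i3 := ((gEs a).mul_prod (gxEc b)).const_mul q
  have i4 := ((gEc a).mul_prod (gxEs b)).const_mul q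
  have e : (fun k : ℝ × ℝ => exp (-k.1 ^ 2 / 2) * exp (-k.2 ^ 2 / 2) *
      ((p * k.1 + q * k.2) * sin (a * k.1 + b * k.2))) = fun k : ℝ × ℝ =>
      ((p * ((k.1 * exp (-k.1 ^ 2 / 2) * sin (a * k.1)) * (exp (-k.2 ^ 2 / 2) * cos (b * k.2))) +
      p * ((k.1 * exp (-k.1 ^ 2 / 2) * cos (a * k.1)) * (exp (-k.2 ^ 2 / 2) * sin (b * k.2)))) +
      q * ((exp (-k.1 ^ 2 / 2) * sin (a * k.1)) * (k.2 * exp (-k.2 ^ 2 / 2) * cos (b * k.2)))) +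
      q * ((exp (-k.1 ^ 2 / 2) * cos (a * k.1)) * (k.2 * exp (-k.2 ^ 2 / 2) * sin (b * k.2))) := by
    funext k; rw [sin_add]; ring
  rw [e, Measure.volume_eq_prod]
  refine ⟨((i1.fun_add i2).fun_add i3).fun_add i4, ?_⟩
  rw [integral_add ((i1.fun_add i2).fun_add i3) i4, integral_add (i1.fun_add i2) i3, integral_add i1 i2]
  simp only [integral_const_mul]
  erw [integral_prod_mul (fun x : ℝ => x * exp (-x ^ 2 / 2) * sin (a * x))
    (fun x : ℝ => exp (-x ^ 2 / 2) * cos (b * x)),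
    integral_prod_mul (fun x : ℝ => x * exp (-x ^ 2 / 2) * cos (a * x))
    (fun x : ℝ => exp (-x ^ 2 / 2) * sin (b * x)),
    integral_prod_mul (fun x : ℝ => exp (-x ^ 2 / 2) * sin (a * x))
    (fun x : ℝ => x * exp (-x ^ 2 / 2) * cos (b * x)),
    integral_prod_mul (fun x : ℝ => exp (-x ^ 2 / 2) * cos (a * x))
    (fun x : ℝ => x * exp (-x ^ 2 / 2) * sin (b * x))]
  rw [vEc, vEc, vEs, vEs, vxEc, vxEc, vxEs, vxEs]
  have : exp (-(a ^ 2 + b ^ 2) / 2) = exp (-a ^ 2 / 2) * exp (-b ^ 2 / 2) := by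
    rw [← exp_add]; congr 1; ring
  rw [this]
  have h := Real.mul_self_sqrt (show 0 ≤ 2 * π by positivity)
  linear_combination ((p * a + q * b) * exp (-a ^ 2 / 2) * exp (-b ^ 2 / 2)) * h

/-- Gaussian integral over the plane for fixed angles. -/
lemma gauss_plane (r τ φ : ℝ) :
    ∫ k : ℝ × ℝ, exp (-k.1 ^ 2 / 2) * exp (-k.2 ^ 2 / 2) * cos (r * k.2) *
      (cos (τ * (k.1 * sin φ + k.2 * cos φ)) -
        τ * (k.1 * sin φ + k.2 * cos φ) * sin (τ * (k.1 * sin φ + k.2 * cos φ)))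
      = 2 * π * exp (-(r ^ 2 + τ ^ 2) / 2) *
        ((1 - τ ^ 2) * cosh (r * τ * cos φ) + r * τ * (cos φ * sinh (r * τ * cos φ))) := by
  obtain ⟨i1, v1⟩ := P2 (τ * sin φ) (τ * cos φ + r)
  obtain ⟨i2, v2⟩ := P2 (τ * sin φ) (τ * cos φ - r)
  obtain ⟨i3, v3⟩ := Q2 (τ * sin φ) (τ * cos φ) (τ * sin φ) (τ * cos φ + r)
  obtain ⟨i4, v4⟩ := Q2 (τ * sin φ) (τ * cos φ) (τ * sin φ) (τ * cos φ - r)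
  have key : ∀ k : ℝ × ℝ, exp (-k.1 ^ 2 / 2) * exp (-k.2 ^ 2 / 2) * cos (r * k.2) *
      (cos (τ * (k.1 * sin φ + k.2 * cos φ)) -
        τ * (k.1 * sin φ + k.2 * cos φ) * sin (τ * (k.1 * sin φ + k.2 * cos φ))) =
      (1 / 2) * (((exp (-k.1 ^ 2 / 2) * exp (-k.2 ^ 2 / 2) *
        cos (τ * sin φ * k.1 + (τ * cos φ + r) * k.2) +
      exp (-k.1 ^ 2 / 2) * exp (-k.2 ^ 2 / 2) *
        cos (τ * sin φ * k.1 + (τ * cos φ - r) * k.2)) -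
      exp (-k.1 ^ 2 / 2) * exp (-k.2 ^ 2 / 2) * ((τ * sin φ * k.1 + τ * cos φ * k.2) *
        sin (τ * sin φ * k.1 + (τ * cos φ + r) * k.2))) -
      exp (-k.1 ^ 2 / 2) * exp (-k.2 ^ 2 / 2) * ((τ * sin φ * k.1 + τ * cos φ * k.2) *
        sin (τ * sin φ * k.1 + (τ * cos φ - r) * k.2))) := by
    intro k
    have e1 : τ * sin φ * k.1 + (τ * cos φ + r) * k.2 =
      τ * (k.1 * sin φ + k.2 * cos φ) + r * k.2 := by ring
    have e2 : τ * sin φ * k.1 + (τ * cos φ - r) * k.2 =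
      τ * (k.1 * sin φ + k.2 * cos φ) - r * k.2 := by ring
    rw [e1, e2, cos_add, cos_sub, sin_add, sin_sub]
    ring
  simp only [key]
  rw [integral_const_mul, integral_sub ((i1.fun_add i2).sub' i3) i4, integral_sub (i1.fun_add i2) i3,
    integral_add i1 i2, v1, v2, v3, v4, cosh_eq, sinh_eq]
  have s1 := sin_sq_add_cos_sq φ
  have x1 : exp (-((τ * sin φ) ^ 2 + (τ * cos φ + r) ^ 2) / 2) =
      exp (-(r ^ 2 + τ ^ 2) / 2) * exp (-(r * τ * cos φ)) := by
    rw [← exp_add]; congr 1; linear_combination (-τ ^ 2 / 2) * s1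
  have x2 : exp (-((τ * sin φ) ^ 2 + (τ * cos φ - r) ^ 2) / 2) =
      exp (-(r ^ 2 + τ ^ 2) / 2) * exp (r * τ * cos φ) := by
    rw [← exp_add]; congr 1; linear_combination (-τ ^ 2 / 2) * s1
  rw [x1, x2]
  linear_combination (-π * τ ^ 2 * exp (-(r ^ 2 + τ ^ 2) / 2) * (exp (r * τ * cos φ) +
    exp (-(r * τ * cos φ)))) * s1

/-- `g y = cos y - y sin y`. -/
noncomputable def gfun (y : ℝ) : ℝ := cos y - y * sin y

lemma gfun_cont : Continuous gfun := by unfold gfun; fun_prop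

lemma gfun_hasSum (y : ℝ) :
    HasSum (fun n : ℕ => (-1) ^ n * (2 * n + 1) * y ^ (2 * n) / ((2 * n).factorial : ℝ))
      (gfun y) := by
  have h1 := Real.hasSum_cos y
  have h2 := (Real.hasSum_sin y).mul_left (-y)
  have h3 : HasSum (fun n : ℕ => (-1) ^ n * (2 * n) * y ^ (2 * n) / ((2 * n).factorial : ℝ))
      (-y * sin y) := by
    have := (hasSum_nat_add_iff (f := fun n : ℕ => (-1 : ℝ) ^ n * (2 * n) * y ^ (2 * n) /
      ((2 * n).factorial : ℝ)) (g := -y * sin y) 1).1 (by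
        refine Eq.mp (congrArg (fun f => HasSum f (-y * sin y)) (funext fun n => ?_)) h2
        have : (2 * (n + 1)).factorial = (2 * n + 2) * (2 * n + 1).factorial := by
          rw [show 2 * (n + 1) = (2 * n + 1) + 1 by ring, Nat.factorial_succ]
        rw [this]
        have h0 : ((2 * n + 1).factorial : ℝ) ≠ 0 := by positivity
        push_cast
        field_simp
        ring)
    simpa using this
  convert h1.add h3 using 1
  · funext n; ring
  · unfold gfun; ring

/-- The angular measure. -/
noncomputable def angM : Measure (ℝ × ℝ) :=
  (volume.restrict (Ioc 0 π)).prod (volume.restrict (Ioc (-π) π))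

instance : IsFiniteMeasure angM := by unfold angM; infer_instance

lemma angM_int {f : ℝ × ℝ → ℝ} (hf : Continuous f) : Integrable f angM := by
  unfold angM
  rw [Measure.prod_restrict]
  have : IntegrableOn f (Icc 0 π ×ˢ Icc (-π) π) (volume.prod volume) :=
    hf.continuousOn.integrableOn_compact (isCompact_Icc.prod isCompact_Icc)
  exact this.mono_set (prod_mono Ioc_subset_Icc_self Ioc_subset_Icc_self)

lemma angM_iter {f : ℝ × ℝ → ℝ} (hf : Continuous f) :
    ∫ p, f p ∂angM = ∫ θ in (0 : ℝ)..π, ∫ φ in (-π)..π, f (θ, φ) := by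
  have h := integral_prod f (show Integrable f ((volume.restrict (Ioc 0 π)).prod
    (volume.restrict (Ioc (-π) π))) from angM_int hf)
  unfold angM
  rw [h, intervalIntegral.integral_of_le pi_pos.le]
  simp only [intervalIntegral.integral_of_le (neg_le_self pi_pos.le)]

lemma even_int {f : ℝ → ℝ} (hf : Continuous f) (h : ∀ x, f (-x) = f x) (a : ℝ) :
    ∫ x in (-a)..a, f x = 2 * ∫ x in (0 : ℝ)..a, f x := by
  rw [← intervalIntegral.integral_add_adjacent_intervals (b := 0)
    (hf.intervalIntegrable _ _) (hf.intervalIntegrable _ _)]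
  have := intervalIntegral.integral_comp_neg (a := 0) (b := a) f
  simp only [h, neg_zero] at this
  rw [← this]; ring

lemma wallis (n : ℕ) : (∫ x in (0 : ℝ)..π, sin x ^ (2 * n + 1)) *
    (∫ x in (-π)..π, sin x ^ (2 * n)) = 4 * π / (2 * n + 1) := by
  rw [even_int (by fun_prop) (fun x => by rw [sin_neg, Even.neg_pow (even_two_mul n)]),
    integral_sin_pow_odd, integral_sin_pow_even]
  induction n with
  | zero => simp; ring
  | succ k ih =>
    rw [Finset.prod_range_succ, Finset.prod_range_succ]
    have e : ∀ A B c d : ℝ, 2 * (A * c) * (2 * (π * (B * d))) = (2 * A * (2 * (π * B))) * (c * d) :=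
      by intros; ring
    rw [e, ih]
    push_cast
    have h1 : (2 * (k:ℝ) + 1) ≠ 0 := by positivity
    have h2 : (2 * (k:ℝ) + 2) ≠ 0 := by positivity
    have h3 : (2 * (k:ℝ) + 3) ≠ 0 := by positivity
    have h4 : (2 * ((k:ℝ) + 1) + 1) ≠ 0 := by positivity
    field_simp
    ring

lemma cos_rep (x : ℝ) : ∫ p, sin p.1 * gfun (x * sin p.1 * sin p.2) ∂angM = 4 * π * cos x := by
  set c : ℕ → ℝ := fun n => (-1) ^ n * (2 * n + 1) * x ^ (2 * n) / ((2 * n).factorial : ℝ) with hc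
  set F : ℕ → ℝ × ℝ → ℝ := fun n p => c n * (sin p.1 ^ (2 * n + 1) * sin p.2 ^ (2 * n)) with hF
  have hFi : ∀ n, Integrable (F n) angM := fun n => angM_int (by simp only [hF]; fun_prop)
  have hsum : Summable fun n => ∫ p, ‖F n p‖ ∂angM := by
    have hs : Summable fun n => |c n| * angM.real univ := ((gfun_hasSum x).summable.abs).mul_right _
    refine Summable.of_nonneg_of_le (fun n => integral_nonneg fun p => norm_nonneg _) (fun n => ?_) hs
    have : ∫ p, ‖F n p‖ ∂angM ≤ ∫ p, |c n| ∂angM := by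
      refine integral_mono (hFi n).norm (integrable_const _) fun p => ?_
      simp only [hF, norm_mul, norm_pow, Real.norm_eq_abs]
      have a1 : |sin p.1| ^ (2 * n + 1) ≤ 1 := pow_le_one₀ (abs_nonneg _) (abs_sin_le_one _)
      have a2 : |sin p.2| ^ (2 * n) ≤ 1 := pow_le_one₀ (abs_nonneg _) (abs_sin_le_one _)
      have a3 : |sin p.1| ^ (2 * n + 1) * |sin p.2| ^ (2 * n) ≤ 1 :=
        mul_le_one₀ a1 (by positivity) a2
      exact mul_le_of_le_one_right (abs_nonneg _) a3
    refine this.trans (le_of_eq ?_)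
    rw [integral_const, smul_eq_mul, mul_comm]
  have h := hasSum_integral_of_summable_integral_norm hFi hsum
  have e1 : ∀ p : ℝ × ℝ, ∑' n, F n p = sin p.1 * gfun (x * sin p.1 * sin p.2) := by
    intro p
    have := ((gfun_hasSum (x * sin p.1 * sin p.2)).mul_left (sin p.1)).tsum_eq
    rw [← this]
    congr 1; funext n
    simp only [hF, hc, mul_pow]
    ring
  have e2 : ∀ n, ∫ p, F n p ∂angM = 4 * π * ((-1) ^ n * x ^ (2 * n) / ((2 * n).factorial : ℝ)) := by
    intro n
    simp only [hF]
    rw [integral_const_mul]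
    unfold angM
    rw [integral_prod_mul (fun x : ℝ => sin x ^ (2 * n + 1)) (fun x : ℝ => sin x ^ (2 * n)),
      ← intervalIntegral.integral_of_le pi_pos.le,
      ← intervalIntegral.integral_of_le (neg_le_self pi_pos.le), wallis]
    simp only [hc]
    have h1 : (2 * (n:ℝ) + 1) ≠ 0 := by positivity
    field_simp
  simp only [e1, e2] at h
  exact h.unique ((Real.hasSum_cos x).mul_left (4 * π))

lemma cos_rep_shift (x ψ : ℝ) :
    ∫ p, sin p.1 * gfun (x * sin p.1 * sin (p.2 + ψ)) ∂angM = 4 * π * cos x := by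
  have hg := gfun_cont
  rw [← cos_rep, angM_iter (by fun_prop), angM_iter (by fun_prop)]
  congr 1; funext θ
  simp only
  rw [intervalIntegral.integral_comp_add_right (fun φ => sin θ * gfun (x * sin θ * sin φ))]
  have hp : Function.Periodic (fun φ => sin θ * gfun (x * sin θ * sin φ)) (2 * π) := by
    intro φ; simp only [sin_add_two_pi]
  have := hp.intervalIntegral_add_eq (-π + ψ) (-π)
  rw [show -π + ψ + 2 * π = π + ψ by ring, show -π + 2 * π = π by ring] at this
  exact this

lemma J0_full (x : ℝ) : ∫ ψ in (-π)..π, cos (x * sin ψ) = 2 * π * J0 x := by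
  rw [even_int (by fun_prop) (fun y => by simp), J0]
  have := pi_ne_zero
  field_simp

lemma refl_int (f : ℝ → ℝ) : ∫ φ in (0 : ℝ)..π, f (π - φ) = ∫ φ in (0 : ℝ)..π, f φ := by
  rw [intervalIntegral.integral_comp_sub_left (fun x => f x)]; simp

lemma I0_full (z : ℝ) : ∫ φ in (-π)..π, cosh (z * cos φ) = 2 * π * besselI 0 z := by
  rw [even_int (by fun_prop) (fun y => by simp), besselI]
  have h := refl_int (fun φ => exp (z * cos φ))
  simp only [cos_pi_sub, mul_neg] at h
  simp only [cosh_eq, intervalIntegral.integral_div]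
  rw [intervalIntegral.integral_add (Continuous.intervalIntegrable (by fun_prop) _ _)
    (Continuous.intervalIntegrable (by fun_prop) _ _), h]
  have := pi_ne_zero
  simp
  field_simp

lemma I1_full (z : ℝ) : ∫ φ in (-π)..π, cos φ * sinh (z * cos φ) = 2 * π * besselI 1 z := by
  rw [even_int (by fun_prop) (fun y => by simp), besselI]
  have h := refl_int (fun φ => exp (z * cos φ) * cos φ)
  simp only [cos_pi_sub, mul_neg, intervalIntegral.integral_neg] at h
  have e : ∀ φ, cos φ * sinh (z * cos φ) =
    (exp (z * cos φ) * cos φ - exp (-(z * cos φ)) * cos φ) / 2 := by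
    intro φ; rw [sinh_eq]; ring
  simp only [e, intervalIntegral.integral_div]
  rw [intervalIntegral.integral_sub (Continuous.intervalIntegrable (by fun_prop) _ _)
    (Continuous.intervalIntegrable (by fun_prop) _ _)]
  have := pi_ne_zero
  simp only [Nat.cast_one, one_mul]
  rw [← h]
  field_simp
  linarith

lemma besselI_cont (j : ℕ) : Continuous (besselI j) := by
  unfold besselI
  refine continuous_const.mul
    (intervalIntegral.continuous_parametric_intervalIntegral_of_continuous' ?_ _ _)
  unfold Function.uncurry
  fun_prop

lemma Jjn_eq (j n : ℕ) (t r : ℝ) : Jjn j n t r = ∫ α in (0 : ℝ)..(π / 2),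
    exp (-(r ^ 2 + (t * cos α) ^ 2) / 2) * besselI j (r * (t * cos α)) * cos α ^ n := by
  have hpi := pi_pos
  unfold Jjn
  rw [intervalIntegral.integral_of_le zero_le_one, intervalIntegral.integral_of_le (by positivity),
    integral_Ioc_eq_integral_Ioo, integral_Ioc_eq_integral_Ioo]
  have hinj : InjOn (fun α => 1 - cos α) (Ioo 0 (π / 2)) := by
    intro a ha b hb hab
    have : cos a = cos b := by simp only at hab; linarith
    exact injOn_cos ⟨ha.1.le, by linarith [ha.2]⟩ ⟨hb.1.le, by linarith [hb.2]⟩ this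
  have himg : (fun α => 1 - cos α) '' (Ioo 0 (π / 2)) = Ioo 0 1 := by
    ext ξ
    constructor
    · rintro ⟨a, ha, rfl⟩
      have h1 : 0 < cos a := cos_pos_of_mem_Ioo ⟨by linarith [ha.1], ha.2⟩
      have h2 : cos a < 1 := by
        rw [← cos_zero]
        exact cos_lt_cos_of_nonneg_of_le_pi le_rfl (by linarith [ha.2]) ha.1
      exact ⟨by simp only; linarith, by simp only; linarith⟩
    · intro h
      refine ⟨arccos (1 - ξ), ⟨arccos_pos.2 (by linarith [h.1]), ?_⟩, ?_⟩
      · exact arccos_lt_pi_div_two.2 (by linarith [h.2])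
      · simp only
        rw [cos_arccos (by linarith [h.2]) (by linarith [h.1])]; ring
  rw [← himg, integral_image_eq_integral_abs_deriv_smul (f' := fun α => sin α) measurableSet_Ioo
    (fun x _ => by
      have := ((hasDerivAt_cos x).const_sub 1).hasDerivWithinAt (s := Ioo 0 (π / 2))
      simpa using this) hinj]
  refine setIntegral_congr_fun measurableSet_Ioo fun α hα => ?_
  have hs : 0 < sin α := sin_pos_of_pos_of_lt_pi hα.1 (by linarith [hα.2])
  have hsq : √(1 - cos α) * √(2 - (1 - cos α)) = sin α := by
    rw [← Real.sqrt_mul (by linarith [cos_le_one α])]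
    rw [show (1 - cos α) * (2 - (1 - cos α)) = sin α ^ 2 by
      rw [sin_sq]; ring]
    exact Real.sqrt_sq hs.le
  simp only [smul_eq_mul, hsq, abs_of_pos hs, Itilde]
  have hx : exp (-(r ^ 2 + (t * cos α) ^ 2) / 2) = exp (-(r - t + t * (1 - cos α)) ^ 2 / 2) *
      exp (-(r * t * (1 - (1 - cos α)))) := by
    rw [← exp_add]; congr 1; ring
  rw [hx]
  rw [show r * t * (1 - (1 - cos α)) = r * (t * cos α) by ring,
    show 1 - (1 - cos α) = cos α by ring]
  field_simp

lemma half_int {f : ℝ → ℝ} (hf : Continuous f) :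
    ∫ θ in (0 : ℝ)..π, f (sin θ) = 2 * ∫ α in (0 : ℝ)..(π / 2), f (cos α) := by
  rw [← even_int (f := fun α => f (cos α)) (by fun_prop) (fun x => by simp)]
  have := intervalIntegral.integral_comp_add_right (a := -(π/2)) (b := π/2)
    (fun θ => f (sin θ)) (π / 2)
  simp only [sin_add_pi_div_two] at this
  rw [this]
  congr 1 <;> ring

/-- Common integrand over plane and angles. -/
noncomputable def FF (t r : ℝ) (k p : ℝ × ℝ) : ℝ :=
  exp (-k.1 ^ 2 / 2) * exp (-k.2 ^ 2 / 2) * cos (r * k.2) *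
    (sin p.1 * gfun (t * sin p.1 * (k.1 * sin p.2 + k.2 * cos p.2)))

lemma FF_bound (t r : ℝ) (k p : ℝ × ℝ) : |FF t r k p| ≤
    exp (-k.1 ^ 2 / 2) * exp (-k.2 ^ 2 / 2) +
    |t| * (|k.1 * exp (-k.1 ^ 2 / 2)| * exp (-k.2 ^ 2 / 2)) +
    |t| * (exp (-k.1 ^ 2 / 2) * |k.2 * exp (-k.2 ^ 2 / 2)|) := by
  unfold FF
  have hE1 := exp_pos (-k.1 ^ 2 / 2)
  have hE2 := exp_pos (-k.2 ^ 2 / 2)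
  set u := k.1 * sin p.2 + k.2 * cos p.2 with hu
  have h1 : |u| ≤ |k.1| + |k.2| := by
    refine (abs_add_le _ _).trans (add_le_add ?_ ?_)
    · rw [abs_mul]; exact mul_le_of_le_one_right (abs_nonneg _) (abs_sin_le_one _)
    · rw [abs_mul]; exact mul_le_of_le_one_right (abs_nonneg _) (abs_cos_le_one _)
  have h2 : |t * sin p.1 * u| ≤ |t| * (|k.1| + |k.2|) := by
    rw [abs_mul, abs_mul]
    exact mul_le_mul (mul_le_of_le_one_right (abs_nonneg _) (abs_sin_le_one _)) h1 (abs_nonneg _)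
      (abs_nonneg _)
  have h3 : |gfun (t * sin p.1 * u)| ≤ 1 + |t| * (|k.1| + |k.2|) := by
    unfold gfun
    refine (abs_sub _ _).trans (add_le_add (abs_cos_le_one _) ?_)
    rw [abs_mul]
    exact (mul_le_of_le_one_right (abs_nonneg _) (abs_sin_le_one _)).trans h2
  have h4 : |cos (r * k.2)| * (|sin p.1| * |gfun (t * sin p.1 * u)|) ≤
      1 + |t| * (|k.1| + |k.2|) := by
    calc |cos (r * k.2)| * (|sin p.1| * |gfun (t * sin p.1 * u)|)
        ≤ 1 * (1 * |gfun (t * sin p.1 * u)|) := by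
          gcongr
          · exact abs_cos_le_one _
          · exact abs_sin_le_one _
      _ ≤ _ := by simpa using h3
  simp only [abs_mul, abs_of_pos hE1, abs_of_pos hE2]
  calc exp (-k.1 ^ 2 / 2) * exp (-k.2 ^ 2 / 2) * |cos (r * k.2)| *
        (|sin p.1| * |gfun (t * sin p.1 * u)|)
      = exp (-k.1 ^ 2 / 2) * exp (-k.2 ^ 2 / 2) * (|cos (r * k.2)| *
        (|sin p.1| * |gfun (t * sin p.1 * u)|)) := by ring
    _ ≤ exp (-k.1 ^ 2 / 2) * exp (-k.2 ^ 2 / 2) * (1 + |t| * (|k.1| + |k.2|)) := by gcongr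
    _ = _ := by ring

lemma FF_int (t r : ℝ) : Integrable (Function.uncurry (FF t r))
    ((volume : Measure (ℝ × ℝ)).prod angM) := by
  have b1 := gE_int.mul_prod gE_int
  have b2 := (gxE_int.abs.mul_prod gE_int).const_mul |t|
  have b3 := (gE_int.mul_prod gxE_int.abs).const_mul |t|
  have hb := ((b1.fun_add b2).fun_add b3).mul_prod (integrable_const (1 : ℝ) (μ := angM))
  have hg := gfun_cont
  refine Integrable.mono' hb ?_ (Filter.Eventually.of_forall fun q => ?_)
  · refine Continuous.aestronglyMeasurable ?_
    unfold Function.uncurry FF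
    fun_prop
  · rw [mul_one]
    exact FF_bound t r q.1 q.2

lemma right_side (t r : ℝ) : ∫ k : ℝ × ℝ, ∫ p, FF t r k p ∂angM =
    8 * π ^ 2 * (Jjn 0 1 t r - t ^ 2 * Jjn 0 3 t r + r * t * Jjn 1 2 t r) := by
  rw [integral_integral_swap (FF_int t r)]
  have e1 : ∀ p : ℝ × ℝ, ∫ k, FF t r k p = sin p.1 * (2 * π *
      exp (-(r ^ 2 + (t * sin p.1) ^ 2) / 2) *
        ((1 - (t * sin p.1) ^ 2) * cosh (r * (t * sin p.1) * cos p.2) +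
          r * (t * sin p.1) * (cos p.2 * sinh (r * (t * sin p.1) * cos p.2)))) := by
    intro p
    rw [← gauss_plane, ← integral_const_mul]
    congr 1; funext k
    simp only [FF, gfun]
    ring
  simp only [e1]
  rw [angM_iter (by fun_prop)]
  have hI0 := besselI_cont 0
  have hI1 := besselI_cont 1
  have e2 : ∀ θ : ℝ, ∫ φ in (-π)..π, sin θ * (2 * π *
      exp (-(r ^ 2 + (t * sin θ) ^ 2) / 2) *
        ((1 - (t * sin θ) ^ 2) * cosh (r * (t * sin θ) * cos φ) +
          r * (t * sin θ) * (cos φ * sinh (r * (t * sin θ) * cos φ)))) =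
      4 * π ^ 2 * (sin θ * (exp (-(r ^ 2 + (t * sin θ) ^ 2) / 2) *
        ((1 - (t * sin θ) ^ 2) * besselI 0 (r * (t * sin θ)) +
          r * (t * sin θ) * besselI 1 (r * (t * sin θ))))) := by
    intro θ
    rw [intervalIntegral.integral_const_mul, intervalIntegral.integral_const_mul,
      intervalIntegral.integral_add (Continuous.intervalIntegrable (by fun_prop) _ _)
        (Continuous.intervalIntegrable (by fun_prop) _ _),
      intervalIntegral.integral_const_mul, intervalIntegral.integral_const_mul,
      I0_full, I1_full]
    ring
  simp only [e2]
  rw [intervalIntegral.integral_const_mul,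
    half_int (f := fun s => s * (exp (-(r ^ 2 + (t * s) ^ 2) / 2) *
        ((1 - (t * s) ^ 2) * besselI 0 (r * (t * s)) +
          r * (t * s) * besselI 1 (r * (t * s))))) (by fun_prop)]
  rw [Jjn_eq, Jjn_eq, Jjn_eq]
  rw [← intervalIntegral.integral_const_mul (t ^ 2), ← intervalIntegral.integral_const_mul (r * t),
    ← intervalIntegral.integral_sub (Continuous.intervalIntegrable (by fun_prop) _ _)
        (Continuous.intervalIntegrable (by fun_prop) _ _),
    ← intervalIntegral.integral_add (Continuous.intervalIntegrable (by fun_prop) _ _)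
        (Continuous.intervalIntegrable (by fun_prop) _ _)]
  have e3 : ∀ α : ℝ, cos α * (exp (-(r ^ 2 + (t * cos α) ^ 2) / 2) *
        ((1 - (t * cos α) ^ 2) * besselI 0 (r * (t * cos α)) +
          r * (t * cos α) * besselI 1 (r * (t * cos α)))) =
      exp (-(r ^ 2 + (t * cos α) ^ 2) / 2) * besselI 0 (r * (t * cos α)) * cos α ^ 1 -
        t ^ 2 * (exp (-(r ^ 2 + (t * cos α) ^ 2) / 2) * besselI 0 (r * (t * cos α)) * cos α ^ 3) +
        r * t * (exp (-(r ^ 2 + (t * cos α) ^ 2) / 2) * besselI 1 (r * (t * cos α)) *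
          cos α ^ 2) := by
    intro α; ring
  simp only [e3]
  ring

lemma left_side (t r : ℝ) : ∫ k : ℝ × ℝ, ∫ p, FF t r k p ∂angM =
    8 * π ^ 2 * ∫ ω in Ioi (0 : ℝ), ω * exp (-ω ^ 2 / 2) * J0 (r * ω) * cos (t * ω) := by
  rw [← integral_comp_polarCoord_symm]
  have e1 : ∀ q : ℝ × ℝ, q.1 • ∫ p, FF t r (polarCoord.symm q) p ∂angM =
      4 * π * ((q.1 * exp (-q.1 ^ 2 / 2)) * (cos (r * q.1 * sin q.2) * cos (t * q.1))) := by
    intro q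
    rw [polarCoord_symm_apply]
    simp only [FF]
    rw [integral_const_mul]
    have h : ∀ p : ℝ × ℝ, t * sin p.1 * (q.1 * cos q.2 * sin p.2 + q.1 * sin q.2 * cos p.2) =
        t * q.1 * sin p.1 * sin (p.2 + q.2) := by
      intro p; rw [sin_add]; ring
    simp only [h, cos_rep_shift]
    have hx : exp (-q.1 ^ 2 / 2) = exp (-(q.1 * cos q.2) ^ 2 / 2) *
        exp (-(q.1 * sin q.2) ^ 2 / 2) := by
      rw [← exp_add]; congr 1
      linear_combination (q.1 ^ 2 / 2) * sin_sq_add_cos_sq q.2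
    rw [hx, smul_eq_mul, show r * (q.1 * sin q.2) = r * q.1 * sin q.2 by ring]
    ring
  simp only [e1]
  rw [integral_const_mul, polarCoord_target, Measure.volume_eq_prod, setIntegral_prod]
  · have e2 : ∀ ω : ℝ, ∫ ψ in Ioo (-π) π,
        (ω * exp (-ω ^ 2 / 2)) * (cos (r * ω * sin ψ) * cos (t * ω)) =
        2 * π * (ω * exp (-ω ^ 2 / 2) * J0 (r * ω) * cos (t * ω)) := by
      intro ω
      rw [integral_const_mul, integral_mul_const, ← integral_Ioc_eq_integral_Ioo,
        ← intervalIntegral.integral_of_le (neg_le_self pi_pos.le), J0_full]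
      ring
    simp only [e2]
    rw [integral_const_mul]
    ring
  · have hi : Integrable (fun q : ℝ × ℝ => |q.1 * exp (-q.1 ^ 2 / 2)| * 1)
        ((volume.restrict (Ioi 0)).prod (volume.restrict (Ioo (-π) π))) :=
      (gxE_int.abs.integrableOn (s := Ioi 0)).mul_prod
        (integrable_const (1 : ℝ) (μ := volume.restrict (Ioo (-π) π)))
    rw [IntegrableOn, ← Measure.prod_restrict]
    refine hi.mono' (Continuous.aestronglyMeasurable (by fun_prop))
      (Filter.Eventually.of_forall fun q => ?_)
    rw [Real.norm_eq_abs, abs_mul, abs_mul (cos _)]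
    exact mul_le_mul_of_nonneg_left
      (mul_le_one₀ (abs_cos_le_one _) (abs_nonneg _) (abs_cos_le_one _)) (abs_nonneg _)

theorem stmt_14 (t r : ℝ) (ht : 0 ≤ t) (hr : 0 ≤ r) :
    (∫ ω in Set.Ioi (0 : ℝ), ω * Real.exp (-ω ^ 2 / 2) * J0 (r * ω) * Real.cos (t * ω)) =
      Jjn 0 1 t r - t ^ 2 * Jjn 0 3 t r + r * t * Jjn 1 2 t r := by
  have h := (left_side t r).symm.trans (right_side t r)
  have hpi : (8 * π ^ 2) ≠ 0 := by positivity
  exact mul_left_cancel₀ hpi h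
end
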